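/- arXiv:1807.02868 — 2 statements merged into one kernel-verified Lean document; each statement's English description precedes it below -/
import Mathlib

section
/- Let φ be a modal formula. If there exist a valuation ν assigning to each propositional letter an element of P₂ and a point x ∈ ℝ² such that φ is true at x in (ℝ², ν) under the topological semantics, then there exist n ≥ 1, a valuation μ assigning subsets of S_n to the propositional letters, and a world w ∈ S_n such that φ is true at w in the crown frame 𝔠_n under Kripke semantics. That is, every formula satisfiable on the polygonal plane is satisfiable on some crown frame. -/
/-- The Boolean subalgebra of the powerset of `X` generated by a family `G` of subsets. -/
inductive BoolGen {X : Type*} (G : Set (Set X)) : Set X → Prop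
  | base (A : Set X) : A ∈ G → BoolGen G A
  | empty : BoolGen G ∅
  | univ : BoolGen G Set.univ
  | union (A B : Set X) : BoolGen G A → BoolGen G B → BoolGen G (A ∪ B)
  | inter (A B : Set X) : BoolGen G A → BoolGen G B → BoolGen G (A ∩ B)
  | compl (A : Set X) : BoolGen G A → BoolGen G Aᶜ

/-- The closed half-spaces `{x ∈ ℝⁿ : ℓ(x) ≤ a}`. -/
def halfSpaces (n : ℕ) : Set (Set (EuclideanSpace ℝ (Fin n))) :=
  {H | ∃ (l : EuclideanSpace ℝ (Fin n) →ₗ[ℝ] ℝ) (a : ℝ), H = {x | l x ≤ a}}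

/-- Modal formulas over countably many propositional letters, built from
`⊥`, `¬`, `∨` and `◇`. -/
inductive Fml : Type
  | bot : Fml
  | var : ℕ → Fml
  | neg : Fml → Fml
  | or : Fml → Fml → Fml
  | dia : Fml → Fml

/-- Topological semantics: the set of points at which a formula is true,
with `◇` interpreted as topological closure. -/
def topoSem {X : Type*} [TopologicalSpace X] (ν : ℕ → Set X) : Fml → Set X
  | .bot => ∅
  | .var p => ν p
  | .neg φ => (topoSem ν φ)ᶜ
  | .or φ ψ => topoSem ν φ ∪ topoSem ν ψ
  | .dia φ => closure (topoSem ν φ)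

/-- Kripke semantics: the set of worlds of the frame `(W, R)` at which a formula is true. -/
def kripkeSem {W : Type*} (R : W → W → Prop) (ν : ℕ → Set W) : Fml → Set W
  | .bot => ∅
  | .var p => ν p
  | .neg φ => (kripkeSem R ν φ)ᶜ
  | .or φ ψ => kripkeSem R ν φ ∪ kripkeSem R ν ψ
  | .dia φ => {w | ∃ v, R w v ∧ v ∈ kripkeSem R ν φ}

/-- The accessibility relation `Q_n` of the crown frame `𝔠_n` on worlds `Fin (2n+1)`,
where world `0` is the root `r` and world `i` (for `1 ≤ i ≤ 2n`) is `sᵢ`: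
the smallest reflexive relation such that the root sees every `sᵢ`, every even
`sᵢ` with `i < 2n` sees `s_{i-1}` and `s_{i+1}`, and `s_{2n}` sees `s_{2n-1}` and `s₁`. -/
def crownRel (n : ℕ) (x y : Fin (2 * n + 1)) : Prop :=
  x = y ∨ x.val = 0 ∨
    (x.val % 2 = 0 ∧ x.val ≠ 0 ∧
      (y.val + 1 = x.val ∨ y.val = x.val + 1 ∨ (x.val = 2 * n ∧ y.val = 1)))

open Filter Topology

/-! ### Transfer of truth along a local interior map -/

/-- The finite set of propositional letters of a formula. -/
def Fml.letters : Fml → Finset ℕ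
  | .bot => ∅
  | .var p => {p}
  | .neg φ => φ.letters
  | .or φ ψ => φ.letters ∪ ψ.letters
  | .dia φ => φ.letters

/-- Let `f` be an interior map from a space to a finite Kripke frame which, on an open set `U`,
is compatible with the two valuations on the letters of `φ`. Then `f` preserves the truth
of `φ` on `U`. -/
theorem mem_topoSem_iff_mem_kripkeSem {X W : Type*} [TopologicalSpace X] {R : W → W → Prop}
    {f : X → W} (forth : ∀ x, ∀ᶠ y in 𝓝 x, R (f x) (f y))
    (back : ∀ x v, R (f x) v → ∃ᶠ y in 𝓝 x, f y = v)
    {ν : ℕ → Set X} {μ : ℕ → Set W} {U : Set X} (hU : IsOpen U) (φ : Fml)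
    (hφ : ∀ p ∈ φ.letters, ∀ x ∈ U, (x ∈ ν p ↔ f x ∈ μ p)) :
    ∀ x ∈ U, (x ∈ topoSem ν φ ↔ f x ∈ kripkeSem R μ φ) := by
  induction φ with
  | bot => intro x _; exact Iff.rfl
  | var p => exact hφ p (by simp [Fml.letters])
  | neg φ ih => intro x hx; exact not_congr (ih hφ x hx)
  | or φ ψ ihφ ihψ =>
    intro x hx
    exact or_congr
      (ihφ (fun p hp => hφ p (Finset.mem_union_left _ hp)) x hx)
      (ihψ (fun p hp => hφ p (Finset.mem_union_right _ hp)) x hx)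
  | dia φ ih =>
    intro x hx
    have hxU : ∀ᶠ y in 𝓝 x, y ∈ U := hU.mem_nhds hx
    simp only [topoSem, kripkeSem, mem_closure_iff_frequently, Set.mem_ofPred_eq]
    constructor
    · intro h
      obtain ⟨y, hy, hyU, hxy⟩ := (h.and_eventually (hxU.and (forth x))).exists
      exact ⟨f y, hxy, (ih hφ y hyU).1 hy⟩
    · rintro ⟨v, hv, hvφ⟩
      refine ((back x v hv).and_eventually hxU).mono ?_
      rintro y ⟨rfl, hyU⟩
      exact (ih hφ y hyU).2 hvφ

/-! ### The subdivision of the line by finitely many points -/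

/-- The position of `θ` with respect to the finite set `F`: the elements of `F` receive
the even indices `2, 4, …` in increasing order, and the complementary intervals the odd ones. -/
noncomputable def intervalIndex (F : Finset ℝ) (θ : ℝ) : ℕ :=
  (F.filter (· < θ)).card + (F.filter (· ≤ θ)).card + 1

theorem intervalIndex_def (F : Finset ℝ) (θ : ℝ) : intervalIndex F θ =
    (F.filter (· < θ)).card + (F.filter (· ≤ θ)).card + 1 :=
  rfl

theorem card_filter_le_eq (F : Finset ℝ) (θ : ℝ) :
    (F.filter (· ≤ θ)).card = (F.filter (· < θ)).card + if θ ∈ F then 1 else 0 := by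
  have h : F.filter (· ≤ θ) = F.filter (· < θ) ∪ F.filter (· = θ) := by
    rw [← Finset.filter_or]
    simp only [le_iff_lt_or_eq]
  rw [h, Finset.card_union_of_disjoint, Finset.filter_eq']
  · split_ifs <;> simp
  · exact Finset.disjoint_filter.2 fun _ _ h => h.ne

theorem eventually_nhdsGT_intervalIndex (F : Finset ℝ) (θ : ℝ) :
    ∀ᶠ η in 𝓝[>] θ, intervalIndex F η = 2 * (F.filter (· ≤ θ)).card + 1 := by
  have h : ∀ᶠ η in 𝓝[>] θ, ∀ t ∈ F, θ < t → η < t := by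
    rw [Filter.eventually_all_finset]
    intro t _
    by_cases ht : θ < t
    · exact ((eventually_lt_nhds ht).filter_mono nhdsWithin_le_nhds).mono fun _ h _ => h
    · simp [ht]
  filter_upwards [h, self_mem_nhdsWithin] with η hη (hθ : θ < η)
  have h₁ : F.filter (· < η) = F.filter (· ≤ θ) := Finset.filter_congr fun t ht =>
    ⟨fun h => not_lt.1 fun h' => h.not_gt (hη t ht h'), fun h => h.trans_lt hθ⟩
  have h₂ : F.filter (· ≤ η) = F.filter (· ≤ θ) := Finset.filter_congr fun t ht =>
    ⟨fun h => not_lt.1 fun h' => h.not_gt (hη t ht h'), fun h => h.trans hθ.le⟩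
  rw [intervalIndex, h₁, h₂, two_mul]

theorem eventually_nhdsLT_intervalIndex (F : Finset ℝ) (θ : ℝ) :
    ∀ᶠ η in 𝓝[<] θ, intervalIndex F η = 2 * (F.filter (· < θ)).card + 1 := by
  have h : ∀ᶠ η in 𝓝[<] θ, ∀ t ∈ F, t < θ → t < η := by
    rw [Filter.eventually_all_finset]
    intro t _
    by_cases ht : t < θ
    · exact ((eventually_gt_nhds ht).filter_mono nhdsWithin_le_nhds).mono fun _ h _ => h
    · simp [ht]
  filter_upwards [h, self_mem_nhdsWithin] with η hη (hθ : η < θ)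
  have h₁ : F.filter (· < η) = F.filter (· < θ) := Finset.filter_congr fun t ht =>
    ⟨fun h => h.trans hθ, hη t ht⟩
  have h₂ : F.filter (· ≤ η) = F.filter (· < θ) := Finset.filter_congr fun t ht =>
    ⟨fun h => h.trans_lt hθ, fun h => (hη t ht h).le⟩
  rw [intervalIndex, h₁, h₂, two_mul]

theorem eventually_nhds_intervalIndex (F : Finset ℝ) (θ : ℝ) :
    ∀ᶠ η in 𝓝 θ, intervalIndex F η = intervalIndex F θ ∨
      intervalIndex F η = 2 * (F.filter (· < θ)).card + 1 ∨
      intervalIndex F η = 2 * (F.filter (· ≤ θ)).card + 1 := by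
  rw [← nhdsNE_sup_pure, ← nhdsLT_sup_nhdsGT, eventually_sup, eventually_sup, eventually_pure]
  exact ⟨⟨(eventually_nhdsLT_intervalIndex F θ).mono fun _ h => .inr (.inl h),
    (eventually_nhdsGT_intervalIndex F θ).mono fun _ h => .inr (.inr h)⟩, .inl rfl⟩

/-- Two distinct points with the same index lie in the same complementary interval. -/
theorem notMem_of_intervalIndex_eq {F : Finset ℝ} {θ η t : ℝ}
    (h : intervalIndex F θ = intervalIndex F η) (hlt : θ < η) (ht : t ∈ Set.Icc θ η) :
    t ∉ F := by
  intro htF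
  have hη := Finset.card_le_card (Finset.monotone_filter_right F
    (fun s _ (hs : s ≤ θ) => hs.trans_lt hlt) : F.filter (· ≤ θ) ⊆ F.filter (· < η))
  have hθ : F.filter (· < θ) ⊆ F.filter (· < η) :=
    Finset.monotone_filter_right F fun s _ (hs : s < θ) => hs.trans hlt
  have hθη : F.filter (· ≤ θ) ⊆ F.filter (· ≤ η) :=
    Finset.monotone_filter_right F fun s _ (hs : s ≤ θ) => hs.trans hlt.le
  unfold intervalIndex at h
  have h₁ := Finset.eq_of_subset_of_card_le hθ
    (by have := Finset.card_le_card hθη; omega)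
  have h₂ := Finset.eq_of_subset_of_card_le hθη
    (by have := Finset.card_le_card hθ; omega)
  have h₃ : t ∈ F.filter (· ≤ θ) := h₂ ▸ Finset.mem_filter.2 ⟨htF, ht.2⟩
  have htθ : t = θ := le_antisymm (Finset.mem_filter.1 h₃).2 ht.1
  have h₄ : θ ∈ F.filter (· < θ) := h₁ ▸ Finset.mem_filter.2 ⟨htθ ▸ htF, hlt⟩
  exact lt_irrefl _ (Finset.mem_filter.1 h₄).2

theorem exists_card_filter_lt_eq (F : Finset ℝ) {k : ℕ} (hk : k < F.card) :
    ∃ t ∈ F, (F.filter (· < t)).card = k := by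
  have hlt : ∀ {s t : ℝ}, s ∈ F → s < t → (F.filter (· < s)).card < (F.filter (· < t)).card := by
    intro s t hs hst
    refine Finset.card_lt_card (Finset.ssubset_iff_of_subset
      (Finset.monotone_filter_right F fun u _ (hu : u < s) => hu.trans hst) |>.2 ⟨s, ?_, ?_⟩)
    · simp [hs, hst]
    · simp
  have hinj : Set.InjOn (fun t => (F.filter (· < t)).card) F := by
    intro s hs t ht h
    rcases lt_trichotomy s t with h' | h' | h'
    · exact absurd h (hlt hs h').ne
    · exact h'
    · exact absurd h (hlt ht h').ne'
  have himg : F.image (fun t => (F.filter (· < t)).card) = Finset.range F.card := by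
    refine Finset.eq_of_subset_of_card_le (fun k hk => ?_) ?_
    · obtain ⟨t, ht, rfl⟩ := Finset.mem_image.1 hk
      exact Finset.mem_range.2 (Finset.card_lt_card (Finset.filter_ssubset.2 ⟨t, ht, by simp⟩))
    · rw [Finset.card_image_of_injOn hinj, Finset.card_range]
  simpa using himg.ge (Finset.mem_range.2 hk)

/-- Every index from `1` to `2 * F.card` is attained in the interval `(a, b]` if `F ⊆ (a, b]`. -/
theorem exists_intervalIndex_eq {F : Finset ℝ} {a b : ℝ} (hF : (F : Set ℝ) ⊆ Set.Ioc a b) {v : ℕ}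
    (hv : 1 ≤ v) (hv' : v ≤ 2 * F.card) : ∃ θ ∈ Set.Ioc a b, intervalIndex F θ = v := by
  obtain ⟨t, ht, hcard⟩ := exists_card_filter_lt_eq F (k := (v - 1) / 2) (by omega)
  have hta := hF ht
  rcases Nat.even_or_odd' v with ⟨k, rfl | rfl⟩
  · refine ⟨t, hta, ?_⟩
    rw [intervalIndex, card_filter_le_eq, if_pos ht, hcard]
    omega
  · have hev : ∀ᶠ η in 𝓝[<] t, a < η ∧ η < t :=
      Ioo_mem_nhdsLT hta.1
    obtain ⟨η, hη, h₁, h₂⟩ := ((eventually_nhdsLT_intervalIndex F t).and hev).exists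
    exact ⟨η, ⟨h₁, h₂.le.trans hta.2⟩, by rw [hη, hcard]; omega⟩

theorem intervalIndex_of_forall_lt {F : Finset ℝ} {θ : ℝ} (h : ∀ t ∈ F, θ < t) :
    intervalIndex F θ = 1 := by
  rw [intervalIndex, Finset.filter_false_of_mem fun t ht => (h t ht).not_gt,
    Finset.filter_false_of_mem fun t ht => (h t ht).not_ge]
  rfl

/-! ### The crown map of the complex plane -/

theorem intervalIndex_le {F : Finset ℝ} {b θ : ℝ} (hb : b ∈ F) (hθ : θ ≤ b) :
    intervalIndex F θ ≤ 2 * F.card := by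
  have h : (F.filter (· < θ)).card < F.card :=
    Finset.card_lt_card (Finset.filter_ssubset.2 ⟨b, hb, hθ.not_gt⟩)
  have := card_filter_le_eq F θ
  unfold intervalIndex
  split_ifs at this <;> omega

/-- The map of the complex plane to the crown frame with `2 * F.card` outer worlds given by
the subdivision of the circle of directions by the finite set of angles `F`. -/
noncomputable def crownMap (F : Finset ℝ) (z : ℂ) : Fin (2 * F.card + 1) :=
  Fin.ofNat _ (if z = 0 then 0 else intervalIndex F z.arg)

theorem crownMap_val {F : Finset ℝ} (hπ : Real.pi ∈ F) (z : ℂ) :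
    (crownMap F z).val = if z = 0 then 0 else intervalIndex F z.arg := by
  refine Nat.mod_eq_of_lt (Nat.lt_succ_of_le ?_)
  split_ifs
  · exact Nat.zero_le _
  · exact intervalIndex_le hπ z.arg_le_pi

theorem crownMap_val_of_ne_zero {F : Finset ℝ} (hπ : Real.pi ∈ F) {z : ℂ} (hz : z ≠ 0) :
    (crownMap F z).val = intervalIndex F z.arg := by
  rw [crownMap_val hπ, if_neg hz]

theorem crownMap_val_zero {F : Finset ℝ} (hπ : Real.pi ∈ F) : (crownMap F 0).val = 0 := by
  rw [crownMap_val hπ, if_pos rfl]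

theorem crownMap_val_polar {F : Finset ℝ} (hπ : Real.pi ∈ F) {r θ : ℝ} (hr : 0 < r)
    (hθ : θ ∈ Set.Ioc (-Real.pi) Real.pi) :
    (crownMap F (r * Complex.exp (θ * Complex.I))).val = intervalIndex F θ := by
  rw [crownMap_val_of_ne_zero hπ
    (mul_ne_zero (Complex.ofReal_ne_zero.2 hr.ne') (Complex.exp_ne_zero _)),
    Complex.arg_real_mul _ hr, Complex.arg_exp_mul_I, (toIocMod_eq_self _).2]
  rwa [show -Real.pi + 2 * Real.pi = Real.pi by ring]

theorem card_filter_lt_pi {F : Finset ℝ} (hF : (F : Set ℝ) ⊆ Set.Ioc (-Real.pi) Real.pi)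
    (hπ : Real.pi ∈ F) : (F.filter (· < Real.pi)).card + 1 = F.card := by
  have h := card_filter_le_eq F Real.pi
  rw [if_pos hπ, Finset.filter_true_of_mem fun t ht => (hF ht).2] at h
  exact h.symm

theorem eventually_crownRel_crownMap {F : Finset ℝ} (hF : (F : Set ℝ) ⊆ Set.Ioc (-Real.pi) Real.pi)
    (hπ : Real.pi ∈ F) (z : ℂ) :
    ∀ᶠ w in 𝓝 z, crownRel F.card (crownMap F z) (crownMap F w) := by
  rcases eq_or_ne z 0 with rfl | hz
  · exact Eventually.of_forall fun w => .inr (.inl (crownMap_val_zero hπ))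
  have hev : ∀ᶠ w in 𝓝 z, w ≠ 0 := eventually_ne_nhds hz
  have key : ∀ w ≠ 0, (intervalIndex F w.arg = intervalIndex F z.arg ∨
      intervalIndex F w.arg = 2 * (F.filter (· < z.arg)).card + 1 ∨
      intervalIndex F w.arg = 2 * (F.filter (· ≤ z.arg)).card + 1) →
      crownRel F.card (crownMap F z) (crownMap F w) := by
    intro w hw h
    have hc := card_filter_le_eq F z.arg
    unfold crownRel
    rw [Fin.ext_iff, crownMap_val_of_ne_zero hπ hw, crownMap_val_of_ne_zero hπ hz]
    have hi := intervalIndex_def F z.arg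
    split_ifs at hc <;> omega
  by_cases hs : z ∈ Complex.slitPlane
  · filter_upwards [hev, (Complex.continuousAt_arg hs).eventually
      (eventually_nhds_intervalIndex F z.arg)] with w hw h using key w hw h
  · have harg : z.arg = Real.pi := by
      by_contra h
      exact hs (Complex.mem_slitPlane_iff_arg.2 ⟨h, hz⟩)
    obtain ⟨hre, him⟩ := Complex.arg_eq_pi_iff.1 harg
    have hup := (Complex.continuousWithinAt_arg_of_re_neg_of_im_zero hre him).eventually
      (eventually_nhds_intervalIndex F z.arg)
    have hpos : ∀ᶠ η in 𝓝 (-Real.pi), ∀ t ∈ F, η < t := by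
      rw [Filter.eventually_all_finset]
      exact fun t ht => eventually_lt_nhds (hF ht).1
    have hdown := (Complex.tendsto_arg_nhdsWithin_im_neg_of_re_neg_of_im_zero hre him).eventually
      hpos
    rw [eventually_nhdsWithin_iff] at hup hdown
    filter_upwards [hev, hup, hdown] with w hw h₁ h₂
    rcases le_or_gt 0 w.im with h | h
    · exact key w hw (h₁ h)
    · have hc := card_filter_le_eq F z.arg
      have hn := card_filter_lt_pi hF hπ
      have hi := intervalIndex_def F z.arg
      rw [harg] at hi
      rw [harg, if_pos hπ] at hc
      unfold crownRel
      rw [crownMap_val_of_ne_zero hπ hw, crownMap_val_of_ne_zero hπ hz,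
        intervalIndex_of_forall_lt (h₂ h), harg, hi]
      omega

theorem frequently_crownMap_eq {F : Finset ℝ} (hF : (F : Set ℝ) ⊆ Set.Ioc (-Real.pi) Real.pi)
    (hπ : Real.pi ∈ F) (z : ℂ) (v : Fin (2 * F.card + 1))
    (hv : crownRel F.card (crownMap F z) v) : ∃ᶠ w in 𝓝 z, crownMap F w = v := by
  have hself : crownMap F z = v → ∃ᶠ w in 𝓝 z, crownMap F w = v := fun h =>
    frequently_iff.2 fun hU => ⟨z, mem_of_mem_nhds hU, h⟩
  rcases eq_or_ne z 0 with rfl | hz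
  · rcases Nat.eq_zero_or_pos v.val with h0 | hpos
    · exact hself (Fin.ext ((crownMap_val_zero hπ).trans h0.symm))
    obtain ⟨θ, hθ, hv'⟩ := exists_intervalIndex_eq hF hpos (Nat.lt_succ_iff.1 v.2)
    have hcont : Tendsto (fun r : ℝ => (r * Complex.exp (θ * Complex.I) : ℂ)) (𝓝[>] 0) (𝓝 0) := by
      refine Tendsto.mono_left ?_ nhdsWithin_le_nhds
      have : Continuous fun r : ℝ => (r * Complex.exp (θ * Complex.I) : ℂ) := by fun_prop
      simpa using this.tendsto 0
    refine hcont.frequently (Eventually.frequently ?_)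
    filter_upwards [self_mem_nhdsWithin] with r (hr : 0 < r)
    exact Fin.ext ((crownMap_val_polar hπ hr hθ).trans hv')
  have hnorm : 0 < ‖z‖ := norm_pos_iff.2 hz
  have hcont : Continuous fun θ : ℝ => (‖z‖ * Complex.exp (θ * Complex.I) : ℂ) := by fun_prop
  have polar : ∀ (θ : ℝ) (l : Filter ℝ) [l.NeBot], l ≤ 𝓝 θ →
      (‖z‖ * Complex.exp (θ * Complex.I) : ℂ) = z →
      (∀ᶠ η in l, η ∈ Set.Ioc (-Real.pi) Real.pi) → (∀ᶠ η in l, intervalIndex F η = v) →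
      ∃ᶠ w in 𝓝 z, crownMap F w = v := by
    intro θ l _ hl hθ hmem hidx
    have ht := (hcont.tendsto θ).mono_left hl
    simp only [hθ] at ht
    refine ht.frequently (Eventually.frequently ?_)
    filter_upwards [hmem, hidx] with η h₁ h₂
    exact Fin.ext ((crownMap_val_polar hπ hnorm h₁).trans h₂)
  have hzarg := Complex.norm_mul_exp_arg_mul_I z
  have hc := card_filter_le_eq F z.arg
  have hn := card_filter_lt_pi hF hπ
  have hi := intervalIndex_def F z.arg
  have hlt := v.2
  unfold crownRel at hv
  rw [crownMap_val_of_ne_zero hπ hz, hi] at hv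
  rcases hv with hv | hv | ⟨heven, -, hv⟩
  · exact hself hv
  · omega
  have hmem : z.arg ∈ F := by
    by_contra h
    rw [if_neg h] at hc
    omega
  rw [if_pos hmem] at hc
  rcases hv with hv | hv | ⟨hv, hv₁⟩
  · refine polar z.arg (𝓝[<] z.arg) nhdsWithin_le_nhds hzarg ?_ ?_
    · exact Filter.mem_of_superset (Ioo_mem_nhdsLT z.neg_pi_lt_arg)
        fun η hη => ⟨hη.1, hη.2.le.trans z.arg_le_pi⟩
    · filter_upwards [eventually_nhdsLT_intervalIndex F z.arg] with η h
      omega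
  · have hne : z.arg ≠ Real.pi := by
      intro h
      rw [h] at hc hv
      omega
    refine polar z.arg (𝓝[>] z.arg) nhdsWithin_le_nhds hzarg ?_ ?_
    · exact Filter.mem_of_superset (Ioo_mem_nhdsGT (z.arg_le_pi.lt_of_ne hne))
        fun η hη => ⟨z.neg_pi_lt_arg.trans hη.1, hη.2.le⟩
    · filter_upwards [eventually_nhdsGT_intervalIndex F z.arg] with η h
      omega
  · have harg : z.arg = Real.pi := by
      by_contra hne
      have hlt := Finset.card_lt_card (Finset.filter_ssubset.2
        ⟨Real.pi, hπ, (z.arg_le_pi.lt_of_ne hne).not_ge⟩ : F.filter (· ≤ z.arg) ⊂ F)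
      omega
    refine polar (-Real.pi) (𝓝[>] (-Real.pi)) nhdsWithin_le_nhds ?_ ?_ ?_
    · rw [← hzarg, harg]
      simp [Complex.exp_neg]
    · exact Filter.mem_of_superset (Ioo_mem_nhdsGT (neg_lt_self Real.pi_pos))
        fun η hη => ⟨hη.1, hη.2.le⟩
    · filter_upwards [eventually_nhdsGT_intervalIndex F (-Real.pi)] with η h
      rw [h, Finset.filter_false_of_mem fun t ht => (hF ht).1.not_ge, hv₁]
      rfl

/-- The sign of a linear functional is constant on the fibres of `crownMap F` once `F` contains
the directions of its zeros. -/
theorem linear_nonpos_iff_of_crownMap_eq {F : Finset ℝ} (hπ : Real.pi ∈ F)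
    (L : ℂ →ₗ[ℝ] ℝ) (hL : ∀ z ≠ 0, L z = 0 → z.arg ∈ F) {z w : ℂ}
    (h : crownMap F z = crownMap F w) : L z ≤ 0 ↔ L w ≤ 0 := by
  have hval := congrArg Fin.val h
  rw [crownMap_val hπ, crownMap_val hπ] at hval
  rcases eq_or_ne z 0 with rfl | hz
  · rcases eq_or_ne w 0 with rfl | hw
    · rfl
    · simp [hw, intervalIndex] at hval
  rcases eq_or_ne w 0 with rfl | hw
  · simp [hz, intervalIndex] at hval
  rw [if_neg hz, if_neg hw] at hval
  have hpolar : ∀ u : ℂ, u ≠ 0 → (L u ≤ 0 ↔ L (Complex.exp (u.arg * Complex.I)) ≤ 0) := by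
    intro u hu
    conv_lhs => rw [← Complex.norm_mul_exp_arg_mul_I u, ← Complex.real_smul, map_smul, smul_eq_mul]
    exact smul_nonpos_iff_nonpos_of_pos_left (norm_pos_iff.2 hu)
  rw [hpolar z hz, hpolar w hw]
  have hcont : Continuous fun θ : ℝ => L (Complex.exp (θ * Complex.I)) :=
    L.continuous_of_finiteDimensional.comp (by fun_prop)
  have key : ∀ θ η : ℝ, θ ∈ Set.Ioc (-Real.pi) Real.pi → η ∈ Set.Ioc (-Real.pi) Real.pi →
      θ < η → intervalIndex F θ = intervalIndex F η →
      (L (Complex.exp (θ * Complex.I)) ≤ 0 ↔ L (Complex.exp (η * Complex.I)) ≤ 0) := by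
    intro θ η hθ hη hlt hidx
    have hne : ∀ t ∈ Set.Icc θ η, L (Complex.exp (t * Complex.I)) ≠ 0 := by
      intro t ht h0
      refine notMem_of_intervalIndex_eq hidx hlt ht ?_
      have := hL _ (Complex.exp_ne_zero _) h0
      rwa [Complex.arg_exp_mul_I, (toIocMod_eq_self _).2] at this
      exact ⟨hθ.1.trans_le ht.1, by linarith [ht.2, hη.2]⟩
    by_contra hcon
    have h0 : (0 : ℝ) ∈ (fun θ : ℝ => L (Complex.exp (θ * Complex.I))) '' Set.Icc θ η := by
      rcases le_or_gt (L (Complex.exp (θ * Complex.I))) 0 with h₁ | h₁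
      · exact intermediate_value_Icc hlt.le hcont.continuousOn
          ⟨h₁, le_of_not_ge fun h₂ => hcon (iff_of_true h₁ h₂)⟩
      · exact intermediate_value_Icc' hlt.le hcont.continuousOn
          ⟨le_of_not_gt fun h₂ => hcon (iff_of_false h₁.not_ge h₂.not_ge), h₁.le⟩
    obtain ⟨t, ht, ht0⟩ := h0
    exact hne t ht ht0
  rcases lt_trichotomy z.arg w.arg with hlt | heq | hlt
  · exact key _ _ z.arg_mem_Ioc w.arg_mem_Ioc hlt hval
  · rw [heq]
  · exact (key _ _ w.arg_mem_Ioc z.arg_mem_Ioc hlt hval.symm).symm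

/-- The zeros of a nonzero real-linear functional on `ℂ` have at most two directions. -/
theorem exists_finset_arg_of_linear_eq_zero {L : ℂ →ₗ[ℝ] ℝ} (hL : L ≠ 0) :
    ∃ F : Finset ℝ, (F : Set ℝ) ⊆ Set.Ioc (-Real.pi) Real.pi ∧
      ∀ z ≠ 0, L z = 0 → z.arg ∈ F := by
  have hform : ∀ z, L z = z.re * L 1 + z.im * L Complex.I := by
    intro z
    conv_lhs => rw [← Complex.re_add_im z]
    rw [map_add, ← mul_one (z.re : ℂ), ← Complex.real_smul, ← Complex.real_smul, map_smul,
      map_smul, smul_eq_mul, smul_eq_mul]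
  set a := L 1
  set b := L Complex.I
  have hab : 0 < a ^ 2 + b ^ 2 := by
    rcases eq_or_ne a 0 with ha | ha
    · rcases eq_or_ne b 0 with hb | hb
      · exact absurd (LinearMap.ext fun z => by simp [hform, ha, hb]) hL
      · positivity
    · positivity
  refine ⟨{(⟨-b, a⟩ : ℂ).arg, (-⟨-b, a⟩ : ℂ).arg}, ?_, ?_⟩
  · intro θ hθ
    rcases Finset.mem_insert.1 hθ with rfl | hθ
    · exact Complex.arg_mem_Ioc _
    · rw [Finset.mem_singleton.1 hθ]
      exact Complex.arg_mem_Ioc _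
  · intro z hz h0
    rw [hform] at h0
    set c := (a * z.im - b * z.re) / (a ^ 2 + b ^ 2) with hc
    have hzc : z = (c : ℂ) * ⟨-b, a⟩ := by
      apply Complex.ext
      · rw [Complex.re_ofReal_mul, hc]
        field_simp
        linear_combination a * h0
      · rw [Complex.im_ofReal_mul, hc]
        field_simp
        linear_combination b * h0
    rcases lt_trichotomy c 0 with hneg | h0' | hpos
    · have : z = ((-c : ℝ) : ℂ) * -⟨-b, a⟩ := by
        rw [Complex.ofReal_neg, neg_mul_neg, ← hzc]
      rw [this, Complex.arg_real_mul _ (neg_pos.2 hneg)]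
      simp
    · exact absurd (by rw [hzc, h0', Complex.ofReal_zero, zero_mul]) hz
    · rw [hzc, Complex.arg_real_mul _ hpos]
      simp

/-! ### Polygons near a point -/

/-- The isometry of the Euclidean plane with the complex plane which takes `x` to `0`. -/
noncomputable def planeToComplex (x : EuclideanSpace ℝ (Fin 2)) :
    EuclideanSpace ℝ (Fin 2) ≃ₜ ℂ :=
  (Homeomorph.subRight x).trans Complex.orthonormalBasisOneI.repr.symm.toHomeomorph

theorem repr_planeToComplex (x y : EuclideanSpace ℝ (Fin 2)) :
    Complex.orthonormalBasisOneI.repr (planeToComplex x y) = y - x :=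
  Complex.orthonormalBasisOneI.repr.apply_symm_apply _

/-- Near `x`, a polygon is a union of fibres of the crown map of any sufficiently fine
subdivision of the circle of directions at `x`. -/
theorem BoolGen.exists_finset_mem_iff_of_crownMap_eq {A : Set (EuclideanSpace ℝ (Fin 2))}
    (hA : BoolGen (halfSpaces 2) A) (x : EuclideanSpace ℝ (Fin 2)) :
    ∃ F₀ : Finset ℝ, (F₀ : Set ℝ) ⊆ Set.Ioc (-Real.pi) Real.pi ∧ ∃ U, IsOpen U ∧ x ∈ U ∧
      ∀ F : Finset ℝ, F₀ ⊆ F → (F : Set ℝ) ⊆ Set.Ioc (-Real.pi) Real.pi → Real.pi ∈ F →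
      ∀ y ∈ U, ∀ z ∈ U, crownMap F (planeToComplex x y) = crownMap F (planeToComplex x z) →
      (y ∈ A ↔ z ∈ A) := by
  induction hA with
  | empty => exact ⟨∅, by simp, Set.univ, isOpen_univ, trivial, fun _ _ _ _ _ _ _ _ _ => Iff.rfl⟩
  | univ => exact ⟨∅, by simp, Set.univ, isOpen_univ, trivial, fun _ _ _ _ _ _ _ _ _ => by simp⟩
  | compl A _ ih =>
    obtain ⟨F₀, hF₀, U, hU, hx, h⟩ := ih
    exact ⟨F₀, hF₀, U, hU, hx, fun F h₁ h₂ h₃ y hy z hz heq =>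
      not_congr (h F h₁ h₂ h₃ y hy z hz heq)⟩
  | union A B _ _ ihA ihB =>
    obtain ⟨F₁, hF₁, U₁, hU₁, hx₁, h₁⟩ := ihA
    obtain ⟨F₂, hF₂, U₂, hU₂, hx₂, h₂⟩ := ihB
    refine ⟨F₁ ∪ F₂, by simp [hF₁, hF₂], U₁ ∩ U₂, hU₁.inter hU₂, ⟨hx₁, hx₂⟩, ?_⟩
    intro F hF hF' hπ y hy z hz heq
    exact or_congr (h₁ F (Finset.union_subset_left hF) hF' hπ y hy.1 z hz.1 heq)
      (h₂ F (Finset.union_subset_right hF) hF' hπ y hy.2 z hz.2 heq)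
  | inter A B _ _ ihA ihB =>
    obtain ⟨F₁, hF₁, U₁, hU₁, hx₁, h₁⟩ := ihA
    obtain ⟨F₂, hF₂, U₂, hU₂, hx₂, h₂⟩ := ihB
    refine ⟨F₁ ∪ F₂, by simp [hF₁, hF₂], U₁ ∩ U₂, hU₁.inter hU₂, ⟨hx₁, hx₂⟩, ?_⟩
    intro F hF hF' hπ y hy z hz heq
    exact and_congr (h₁ F (Finset.union_subset_left hF) hF' hπ y hy.1 z hz.1 heq)
      (h₂ F (Finset.union_subset_right hF) hF' hπ y hy.2 z hz.2 heq)
  | base A hA =>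
    obtain ⟨l, a, rfl⟩ := hA
    have hl : Continuous l := l.continuous_of_finiteDimensional
    rcases lt_trichotomy (l x) a with hlt | rfl | hgt
    · refine ⟨∅, by simp, {y | l y < a}, isOpen_lt hl continuous_const, hlt, ?_⟩
      intro _ _ _ _ y (hy : l y < a) z (hz : l z < a) _
      exact iff_of_true (show l y ≤ a from hy.le) (show l z ≤ a from hz.le)
    · let L : ℂ →ₗ[ℝ] ℝ := l ∘ₗ Complex.orthonormalBasisOneI.repr.toLinearEquiv.toLinearMap
      have hmem : ∀ y, l y ≤ l x ↔ L (planeToComplex x y) ≤ 0 := by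
        intro y
        have : L (planeToComplex x y) = l y - l x := by
          rw [← map_sub, ← repr_planeToComplex]
          rfl
        rw [this, sub_nonpos]
      by_cases hL : L = 0
      · refine ⟨∅, by simp, Set.univ, isOpen_univ, trivial, ?_⟩
        intro _ _ _ _ y _ z _ _
        exact iff_of_true ((hmem y).2 (by simp [hL])) ((hmem z).2 (by simp [hL]))
      · obtain ⟨F₀, hF₀, hzero⟩ := exists_finset_arg_of_linear_eq_zero hL
        refine ⟨F₀, hF₀, Set.univ, isOpen_univ, trivial, ?_⟩
        intro F hF hF' hπ y _ z _ heq
        exact (hmem y).trans ((linear_nonpos_iff_of_crownMap_eq hπ L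
          (fun w hw h0 => hF (hzero w hw h0)) heq).trans (hmem z).symm)
    · refine ⟨∅, by simp, {y | a < l y}, isOpen_lt continuous_const hl, hgt, ?_⟩
      intro _ _ _ _ y hy z hz _
      exact iff_of_false (show ¬l y ≤ a from not_le_of_gt hy) (show ¬l z ≤ a from not_le_of_gt hz)

/-- Every modal formula satisfiable on the polygonal plane (under a valuation taking
values in the polygons `P₂`) is satisfiable on some crown frame. -/
theorem satisfiable_on_crown_of_satisfiable_on_polygonal_plane (φ : Fml)
    (h : ∃ ν : ℕ → Set (EuclideanSpace ℝ (Fin 2)),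
      (∀ p, BoolGen (halfSpaces 2) (ν p)) ∧ ∃ x, x ∈ topoSem ν φ) :
    ∃ n, 1 ≤ n ∧ ∃ (μ : ℕ → Set (Fin (2 * n + 1))) (w : Fin (2 * n + 1)),
      w ∈ kripkeSem (crownRel n) μ φ := by
  obtain ⟨ν, hν, x, hx⟩ := h
  choose F₀ hF₀ U hU hxU hUν using fun p => (hν p).exists_finset_mem_iff_of_crownMap_eq x
  let F : Finset ℝ := insert Real.pi (φ.letters.biUnion F₀)
  have hF : (F : Set ℝ) ⊆ Set.Ioc (-Real.pi) Real.pi := by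
    intro θ hθ
    rcases Finset.mem_insert.1 hθ with rfl | hθ
    · exact ⟨neg_lt_self Real.pi_pos, le_rfl⟩
    · obtain ⟨p, _, hp⟩ := Finset.mem_biUnion.1 hθ
      exact hF₀ p hp
  have hπ : Real.pi ∈ F := Finset.mem_insert_self _ _
  let V := ⋂ p ∈ φ.letters, U p
  have hV : IsOpen V := isOpen_biInter_finset fun p _ => hU p
  have hxV : x ∈ V := Set.mem_iInter₂.2 fun p _ => hxU p
  let f := fun y => crownMap F (planeToComplex x y)
  refine ⟨F.card, Finset.card_pos.2 ⟨_, hπ⟩, fun p => f '' (V ∩ ν p), f x, ?_⟩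
  refine (mem_topoSem_iff_mem_kripkeSem (f := f) ?_ ?_ hV φ ?_ x hxV).1 hx
  · intro y
    exact (planeToComplex x).continuous.continuousAt.eventually
      (eventually_crownRel_crownMap hF hπ (planeToComplex x y))
  · intro y v hv
    have := frequently_crownMap_eq hF hπ (planeToComplex x y) v hv
    rwa [← (planeToComplex x).map_nhds_eq, frequently_map] at this
  · intro p hp y hy
    refine ⟨fun h => ⟨y, ⟨hy, h⟩, rfl⟩, ?_⟩
    rintro ⟨z, ⟨hz, hzν⟩, hzy⟩
    exact (hUν p F ((Finset.subset_biUnion_of_mem F₀ hp).trans (Finset.subset_insert _ _)) hF hπ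
      z (Set.mem_iInter₂.1 hz p hp) y (Set.mem_iInter₂.1 hy p hp) hzy).1 hzν
end

section
/- For every modal formula φ: φ is valid on the polygonal plane (true at every point of ℝ² under every valuation taking values in P₂) if and only if φ is valid (true at every world under every valuation into arbitrary subsets, with Kripke semantics) on every finite rooted reflexive-transitive Kripke frame that is not subreducible to any of the forbidden frames 𝔅₁, 𝔅₂, 𝔅₃, 𝔅₄, 𝔅₅. -/
/-- The forbidden frame `𝔅₁`: a two-element cluster with the total relation. -/
def B1Rel : Fin 2 → Fin 2 → Prop := fun _ _ => True

/-- The forbidden frame `𝔅₂`: a two-element cluster `{0,1}` below a reflexive point `2`. -/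
def B2Rel : Fin 3 → Fin 3 → Prop := fun x y => x.val ≤ 1 ∨ x = y

/-- The forbidden frame `𝔅₃` (the trident): a reflexive root `0` seeing three reflexive
endpoints `1`, `2`, `3`, each of which sees only itself. -/
def B3Rel : Fin 4 → Fin 4 → Prop := fun x y => x = 0 ∨ x = y

/-- The forbidden frame `𝔅₄`: a reflexive four-element chain `3 R 2 R 1 R 0`
(relation the reflexive-transitive closure). -/
def B4Rel : Fin 4 → Fin 4 → Prop := fun x y => y.val ≤ x.val

/-- The forbidden frame `𝔅₅`: points `0,1,2,3` (points `1,2,3,4` of the paper) with the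
relation the reflexive-transitive closure of `{(2,1),(1,0),(2,3)}`. -/
def B5Rel : Fin 4 → Fin 4 → Prop := fun x y => x = y ∨ x = 2 ∨ (x = 1 ∧ y = 0)

/-- A subset of a frame is upward closed (a generated subframe) if it contains all
successors of its elements. -/
def UpClosed {W : Type*} (R : W → W → Prop) (D : Set W) : Prop :=
  ∀ x ∈ D, ∀ y, R x y → y ∈ D

/-- `f` is a p-morphism from `(W,R)` to `(W',R')`. -/
def IsPMorphism {W W' : Type*} (R : W → W → Prop) (R' : W' → W' → Prop) (f : W → W') : Prop :=
  (∀ x y, R x y → R' (f x) (f y)) ∧ (∀ x z, R' (f x) z → ∃ y, R x y ∧ f y = z)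

/-- `(W,R)` is subreducible to `(W',R')`: some generated subframe of `(W,R)` admits a
surjective p-morphism onto `(W',R')`. -/
def Subreducible {W W' : Type*} (R : W → W → Prop) (R' : W' → W' → Prop) : Prop :=
  ∃ D : Set W, UpClosed R D ∧ ∃ f : D → W', Function.Surjective f ∧
    IsPMorphism (fun x y : D => R x.val y.val) R' f

open Filter Topology

/-- The propositional letters occurring in a formula. -/
def Fml.vars : Fml → Finset ℕ
  | .bot => ∅
  | .var p => {p}
  | .neg φ => φ.vars
  | .or φ ψ => φ.vars ∪ ψ.vars
  | .dia φ => φ.vars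

/-- A map from an open set to a frame which is locally forth and back preserves truth. -/
theorem topoSem_iff_kripkeSem {X W : Type*} [TopologicalSpace X] {R : W → W → Prop}
    {ν : ℕ → Set X} {μ : ℕ → Set W} {f : X → W} {O : Set X} (hO : IsOpen O)
    (forth : ∀ x ∈ O, ∀ᶠ y in 𝓝 x, R (f x) (f y))
    (back : ∀ x ∈ O, ∀ w, R (f x) w → ∃ᶠ y in 𝓝 x, f y = w)
    (φ : Fml) (hv : ∀ p ∈ φ.vars, ∀ x ∈ O, (x ∈ ν p ↔ f x ∈ μ p)) :
    ∀ x ∈ O, (x ∈ topoSem ν φ ↔ f x ∈ kripkeSem R μ φ) := by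
  induction φ with
  | bot => intro x _; simp [topoSem, kripkeSem]
  | var p => exact hv p (by simp [Fml.vars])
  | neg φ ih => intro x hx; exact not_congr (ih hv x hx)
  | or φ ψ ih₁ ih₂ =>
    intro x hx
    exact or_congr (ih₁ (fun p hp => hv p (by simp [Fml.vars, hp])) x hx)
      (ih₂ (fun p hp => hv p (by simp [Fml.vars, hp])) x hx)
  | dia φ ih =>
    intro x hx
    change x ∈ closure (topoSem ν φ) ↔ ∃ v, R (f x) v ∧ v ∈ kripkeSem R μ φ
    rw [mem_closure_iff_frequently]
    constructor
    · intro h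
      obtain ⟨y, hy, hR, hyO⟩ :=
        (h.and_eventually ((forth x hx).and (hO.mem_nhds hx))).exists
      exact ⟨f y, hR, (ih hv y hyO).1 hy⟩
    · rintro ⟨v, hR, hvφ⟩
      refine ((back x hx v hR).and_eventually (hO.mem_nhds hx)).mono ?_
      rintro y ⟨rfl, hyO⟩
      exact (ih hv y hyO).2 hvφ

section GoodFrames

variable {W : Type*} {R : W → W → Prop}

theorem antisymm_of_not_subreducible (hrefl : ∀ x, R x x)
    (htrans : ∀ x y z, R x y → R y z → R x z)
    (h1 : ¬ Subreducible R B1Rel) (h2 : ¬ Subreducible R B2Rel) {x y : W}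
    (hxy : R x y) (hyx : R y x) : x = y := by
  classical
  by_contra hne
  have hup : UpClosed R {z | R x z} := fun a ha b hab => htrans _ _ _ ha hab
  by_cases hfin : ∀ z, R x z → R z x
  · refine h1 ⟨{z | R x z}, hup, fun z => if z.1 = x then 0 else 1, ?_, fun _ _ _ => trivial, ?_⟩
    · intro i
      fin_cases i
      · exact ⟨⟨x, hrefl x⟩, by simp⟩
      · exact ⟨⟨y, hxy⟩, by simp [Ne.symm hne]⟩
    · rintro ⟨z, hz⟩ i -
      fin_cases i
      · exact ⟨⟨x, hrefl x⟩, hfin z hz, by simp⟩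
      · exact ⟨⟨y, hxy⟩, htrans _ _ _ (hfin z hz) hxy, by simp [Ne.symm hne]⟩
  · push Not at hfin
    obtain ⟨t, hxt, htx⟩ := hfin
    have htne : t ≠ x := by rintro rfl; exact htx (hrefl _)
    refine h2 ⟨{z | R x z}, hup,
      fun z => if z.1 = x then 0 else if R z.1 x then 1 else 2, ?_, ?_, ?_⟩
    · intro i
      fin_cases i
      · exact ⟨⟨x, hrefl x⟩, by simp⟩
      · exact ⟨⟨y, hxy⟩, by simp [Ne.symm hne, hyx]⟩
      · exact ⟨⟨t, hxt⟩, by simp [htne, htx]⟩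
    · rintro ⟨a, ha⟩ ⟨b, hb⟩ hab
      by_cases hax : R a x
      · left; dsimp only; split_ifs <;> simp
      · have hbx : ¬ R b x := fun h => hax (htrans _ _ _ hab h)
        have ha' : a ≠ x := by rintro rfl; exact hax (hrefl _)
        have hb' : b ≠ x := by rintro rfl; exact hbx (hrefl _)
        right; simp [hax, hbx, ha', hb']
    · rintro ⟨a, ha⟩ i hi
      by_cases hax : R a x
      · fin_cases i
        · exact ⟨⟨x, hrefl x⟩, hax, by simp⟩
        · exact ⟨⟨y, hxy⟩, htrans _ _ _ hax hxy, by simp [Ne.symm hne, hyx]⟩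
        · exact ⟨⟨t, hxt⟩, htrans _ _ _ hax hxt, by simp [htne, htx]⟩
      · have ha' : a ≠ x := by rintro rfl; exact hax (hrefl _)
        refine ⟨⟨a, ha⟩, hrefl a, ?_⟩
        rcases hi with hi | hi
        · simp [ha', hax] at hi
        · exact hi

/-- `x` starts a strictly increasing chain with `n` steps. -/
def HasChain (R : W → W → Prop) : ℕ → W → Prop
  | 0, _ => True
  | n + 1, x => ∃ y, R x y ∧ y ≠ x ∧ HasChain R n y

/-- `x` sees only itself. -/
def IsEnd (R : W → W → Prop) (x : W) : Prop := ∀ y, R x y → y = x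

/-- The relation is a partial order. -/
structure IsPoset (R : W → W → Prop) : Prop where
  refl : ∀ x, R x x
  trans : ∀ x y z, R x y → R y z → R x z
  antisymm : ∀ x y, R x y → R y x → x = y

/-- A nonempty subset of a finite poset has a maximal element above a given element of it. -/
theorem IsPoset.exists_maximal [Finite W] (hR : IsPoset R) (P : W → Prop) {x : W} (hx : P x) :
    ∃ y, R x y ∧ P y ∧ ∀ z, R y z → P z → z = y := by
  let _ : PartialOrder W :=
    { le := R, le_refl := hR.refl, le_trans := hR.trans, le_antisymm := hR.antisymm }
  obtain ⟨y, hxy, hy⟩ := (Set.toFinite {z | P z}).exists_le_maximal hx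
  exact ⟨y, hxy, hy.prop, fun z hyz hz => (hy.eq_of_le hz hyz).symm⟩

theorem IsPoset.exists_isEnd [Finite W] (hR : IsPoset R) (x : W) : ∃ y, R x y ∧ IsEnd R y := by
  obtain ⟨y, hxy, -, hy⟩ := hR.exists_maximal (fun _ => True) (x := x) trivial
  exact ⟨y, hxy, fun z hz => hy z hz trivial⟩

theorem IsPoset.hasChain_anti (hR : IsPoset R) {n : ℕ} {x y : W} (hxy : R x y)
    (hy : HasChain R n y) : HasChain R n x := by
  cases n with
  | zero => trivial
  | succ n =>
    obtain ⟨z, hyz, hne, hz⟩ := hy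
    refine ⟨z, hR.trans _ _ _ hxy hyz, ?_, hz⟩
    rintro rfl
    exact hne (hR.antisymm _ _ hxy hyz)

theorem IsPoset.hasChain_of_succ (hR : IsPoset R) {n : ℕ} {x : W} (h : HasChain R (n + 1) x) :
    HasChain R n x := by
  obtain ⟨y, hxy, -, hy⟩ := h
  exact hR.hasChain_anti hxy hy

theorem IsPoset.exists_hasChain [Finite W] (hR : IsPoset R) {n : ℕ} {x : W}
    (h : HasChain R n x) : ∃ y, R x y ∧ HasChain R n y ∧ ¬ HasChain R (n + 1) y := by
  obtain ⟨y, hxy, hy, hmax⟩ := hR.exists_maximal (HasChain R n) h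
  refine ⟨y, hxy, hy, ?_⟩
  rintro ⟨z, hyz, hne, hz⟩
  exact hne (hmax z hyz hz)

theorem IsPoset.not_hasChain_three [Finite W] (hR : IsPoset R) (h4 : ¬ Subreducible R B4Rel)
    (x : W) : ¬ HasChain R 3 x := by
  classical
  intro hx
  let f : W → Fin 4 := fun x =>
    if HasChain R 3 x then 3 else if HasChain R 2 x then 2 else if HasChain R 1 x then 1 else 0
  have f_le : ∀ a, ∀ i : Fin 4, i ≤ f a → HasChain R i.1 a := by
    intro a i hi
    have h32 := hR.hasChain_of_succ (n := 2) (x := a)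
    have h21 := hR.hasChain_of_succ (n := 1) (x := a)
    have h0 : HasChain R 0 a := trivial
    simp only [f] at hi
    fin_cases i <;> split_ifs at hi <;> tauto
  have le_f : ∀ a, ∀ i : Fin 4, HasChain R i.1 a → i ≤ f a := by
    intro a i hi
    have h32 := hR.hasChain_of_succ (n := 2) (x := a)
    have h21 := hR.hasChain_of_succ (n := 1) (x := a)
    simp only [f]
    fin_cases i <;> split_ifs <;> tauto
  have f_eq : ∀ a, ∀ i : Fin 4, HasChain R i.1 a → ¬ HasChain R (i.1 + 1) a → f a = i := by
    intro a i h h'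
    refine le_antisymm ?_ (le_f a i h)
    by_contra hlt
    push Not at hlt
    exact h' (f_le a ⟨i.1 + 1, by omega⟩ hlt)
  refine h4 ⟨Set.univ, fun _ _ _ _ => trivial, fun z => f z.1, ?_, ?_, ?_⟩
  · intro i
    have h3 : (3 : Fin 4) ≤ f x := le_f x 3 hx
    obtain ⟨y, -, hy, hy'⟩ :=
      hR.exists_hasChain (f_le x i (le_trans (Fin.le_last i) h3))
    exact ⟨⟨y, trivial⟩, f_eq y i hy hy'⟩
  · rintro ⟨a, _⟩ ⟨b, _⟩ hab
    exact le_f a _ (hR.hasChain_anti hab (f_le b _ le_rfl))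
  · rintro ⟨a, _⟩ i hi
    obtain ⟨y, hay, hy, hy'⟩ := hR.exists_hasChain (f_le a i hi)
    exact ⟨⟨y, trivial⟩, hay, f_eq y i hy hy'⟩

theorem IsPoset.not_three_ends (hR : IsPoset R) (h3 : ¬ Subreducible R B3Rel) {x a b c : W}
    (hx : ∀ y, R x y → y ≠ x → IsEnd R y) (ha : R x a) (hb : R x b) (hc : R x c)
    (hax : a ≠ x) (hbx : b ≠ x) (hcx : c ≠ x) (hab : a ≠ b) (hac : a ≠ c) (hbc : b ≠ c) :
    False := by
  classical
  refine h3 ⟨{z | R x z}, fun a ha b hab => hR.trans _ _ _ ha hab,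
    fun z => if z.1 = x then 0 else if z.1 = a then 1 else if z.1 = b then 2 else 3, ?_, ?_, ?_⟩
  · intro i
    fin_cases i
    · exact ⟨⟨x, hR.refl x⟩, by simp⟩
    · exact ⟨⟨a, ha⟩, by simp [hax]⟩
    · exact ⟨⟨b, hb⟩, by simp [hbx, hab.symm]⟩
    · exact ⟨⟨c, hc⟩, by simp [hcx, hac.symm, hbc.symm]⟩
  · rintro ⟨u, hu⟩ ⟨v, hv⟩ huv
    by_cases hux : u = x
    · left; simp [hux]
    · have huv' : v = u := hx u hu hux v huv
      subst huv'; right; rfl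
  · rintro ⟨u, hu⟩ i hi
    by_cases hux : u = x
    · subst hux
      fin_cases i
      · exact ⟨⟨u, hR.refl u⟩, hR.refl u, by simp⟩
      · exact ⟨⟨a, ha⟩, ha, by simp [hax]⟩
      · exact ⟨⟨b, hb⟩, hb, by simp [hbx, hab.symm]⟩
      · exact ⟨⟨c, hc⟩, hc, by simp [hcx, hac.symm, hbc.symm]⟩
    · refine ⟨⟨u, hu⟩, hR.refl u, ?_⟩
      rcases hi with hi | hi
      · dsimp only at hi
        rw [if_neg hux] at hi
        split_ifs at hi <;> simp at hi
      · exact hi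

/-- `e` sees exactly itself and the endpoints `a`, `b`. -/
structure IsEdge (R : W → W → Prop) (e a b : W) : Prop where
  left : R e a
  right : R e b
  isEnd_left : IsEnd R a
  isEnd_right : IsEnd R b
  eq_or : ∀ y, R e y → y = e ∨ y = a ∨ y = b

theorem IsEdge.symm {e a b : W} (h : IsEdge R e a b) : IsEdge R e b a :=
  ⟨h.right, h.left, h.isEnd_right, h.isEnd_left, fun y hy => by
    rcases h.eq_or y hy with h | h | h <;> simp [h]⟩

theorem IsPoset.exists_isEdge [Finite W] (hR : IsPoset R) (h3 : ¬ Subreducible R B3Rel) {x : W}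
    (hx : ∀ y, R x y → y ≠ x → IsEnd R y) : ∃ a b, IsEdge R x a b := by
  by_cases hend : IsEnd R x
  · exact ⟨x, x, hR.refl x, hR.refl x, hend, hend, fun y hy => Or.inl (hend y hy)⟩
  · obtain ⟨a, hxa, ha⟩ := hR.exists_isEnd x
    have hax : a ≠ x := by rintro rfl; exact hend ha
    by_cases h : ∃ b, R x b ∧ b ≠ x ∧ b ≠ a
    · obtain ⟨b, hxb, hbx, hba⟩ := h
      refine ⟨a, b, hxa, hxb, ha, hx b hxb hbx, fun y hy => ?_⟩
      by_cases hyx : y = x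
      · exact Or.inl hyx
      · by_contra! hne
        exact hR.not_three_ends h3 hx hxa hxb hy hax hbx hyx hba.symm hne.2.1.symm hne.2.2.symm
    · push Not at h
      refine ⟨a, a, hxa, hxa, ha, ha, fun y hy => ?_⟩
      by_cases hyx : y = x
      · exact Or.inl hyx
      · exact Or.inr (Or.inl (h y hy hyx))

theorem IsPoset.isEnd_of_ne_root [Finite W] (hR : IsPoset R) (h4 : ¬ Subreducible R B4Rel)
    {r : W} (hr : ∀ x, R r x) {x y : W} (hx : x ≠ r) (hxy : R x y) (hyx : y ≠ x) :
    IsEnd R y := by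
  intro z hyz
  by_contra hzy
  exact hR.not_hasChain_three h4 r ⟨x, hr x, hx, y, hxy, hyx, z, hyz, hzy, trivial⟩

theorem IsPoset.exists_isEdge_of_ne_root [Finite W] (hR : IsPoset R)
    (h3 : ¬ Subreducible R B3Rel) (h4 : ¬ Subreducible R B4Rel)
    {r : W} (hr : ∀ x, R r x) {x : W} (hx : x ≠ r) : ∃ a b, IsEdge R x a b :=
  hR.exists_isEdge h3 fun _ => hR.isEnd_of_ne_root h4 hr hx

/-- Two endpoints are linked when some element is an edge between them. -/
def Link (R : W → W → Prop) (a b : W) : Prop := ∃ e, IsEdge R e a b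

theorem IsPoset.reach_of_not_subreducible [Finite W] (hR : IsPoset R)
    (h3 : ¬ Subreducible R B3Rel) (h4 : ¬ Subreducible R B4Rel) (h5 : ¬ Subreducible R B5Rel)
    {r : W} (hr : ∀ x, R r x) {a b : W} (ha : IsEnd R a) (hb : IsEnd R b) :
    Relation.ReflTransGen (Link R) a b := by
  classical
  by_contra hab
  let P : W → Prop := fun x => ∃ c, R x c ∧ IsEnd R c ∧ Relation.ReflTransGen (Link R) a c
  have hrend : ¬ IsEnd R r := by
    intro h
    rw [h a (hr a), h b (hr b)] at hab
    exact hab .refl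
  have ne_root : ∀ {x}, IsEnd R x → x ≠ r := by rintro x hx rfl; exact hrend hx
  have up_ne_root : ∀ {x y}, x ≠ r → R x y → y ≠ r := by
    rintro x y hx hxy rfl
    exact hx (hR.antisymm _ _ hxy (hr x))
  have hP : ∀ {x y}, x ≠ r → R x y → (P x ↔ P y) := by
    intro x y hx hxy
    constructor
    · rintro ⟨c', hxc', hc', hac'⟩
      obtain ⟨c, d, h⟩ := hR.exists_isEdge_of_ne_root h3 h4 hr hx
      rcases h.eq_or y hxy with rfl | hy
      · exact ⟨c', hxc', hc', hac'⟩
      have hyend : IsEnd R y := by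
        rcases hy with rfl | rfl
        exacts [h.isEnd_left, h.isEnd_right]
      refine ⟨y, hR.refl y, hyend, ?_⟩
      rcases h.eq_or c' hxc' with rfl | hc'
      · rwa [hc' y hxy]
      · rcases hc' with rfl | rfl <;> rcases hy with rfl | rfl
        exacts [hac', hac'.tail ⟨x, h⟩, hac'.tail ⟨x, h.symm⟩, hac']
    · rintro ⟨c, hyc, hc, hac⟩
      exact ⟨c, hR.trans _ _ _ hxy hyc, hc, hac⟩
  have hPa : P a := ⟨a, hR.refl a, ha, .refl⟩
  have hPb : ¬ P b := by
    rintro ⟨c, hbc, -, hac⟩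
    rw [hb c hbc] at hac
    exact hab hac
  by_cases hu : ∃ u, u ≠ r ∧ ¬ IsEnd R u
  · obtain ⟨u, hur, hu⟩ := hu
    let Q : W → Prop := fun x => (P x ↔ P u)
    have hQ : ∀ {x y}, x ≠ r → R x y → (Q x ↔ Q y) := fun hx hxy =>
      iff_congr (hP hx hxy) Iff.rfl
    obtain ⟨v, hvr, hv⟩ : ∃ v, v ≠ r ∧ ¬ Q v := by
      by_cases h : P u
      · exact ⟨b, ne_root hb, fun hb' => hPb (hb'.2 h)⟩
      · exact ⟨a, ne_root ha, fun ha' => h (ha'.1 hPa)⟩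
    let f : W → Fin 4 := fun x =>
      if x = r then 2 else if Q x then (if IsEnd R x then 0 else 1) else 3
    have f0 : ∀ x, x ≠ r → Q x → ∃ y, R x y ∧ f y = 0 := by
      intro x hx hQx
      obtain ⟨y, hxy, hy⟩ := hR.exists_isEnd x
      exact ⟨y, hxy, by simp [f, ne_root hy, (hQ hx hxy).1 hQx, hy]⟩
    have hsurj : ∀ i, ∃ x, f x = i := by
      intro i
      fin_cases i
      · obtain ⟨y, -, hy⟩ := f0 u hur Iff.rfl
        exact ⟨y, hy⟩
      · exact ⟨u, by simp [f, hur, hu, Q]⟩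
      · exact ⟨r, by simp [f]⟩
      · exact ⟨v, by simp [f, hvr, hv]⟩
    refine h5 ⟨Set.univ, fun _ _ _ _ => trivial, fun z => f z.1, ?_, ?_, ?_⟩
    · intro i
      obtain ⟨x, hx⟩ := hsurj i
      exact ⟨⟨x, trivial⟩, hx⟩
    · rintro ⟨x, _⟩ ⟨y, _⟩ hxy
      change R x y at hxy
      change B5Rel (f x) (f y)
      by_cases hx : x = r
      · right; left; simp [f, hx]
      · have hy := up_ne_root hx hxy
        by_cases hQx : Q x
        · have hQy := (hQ hx hxy).1 hQx
          by_cases hxe : IsEnd R x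
          · left; rw [hxe y hxy]
          · by_cases hye : IsEnd R y
            · right; right; simp [f, hx, hy, hQx, hQy, hxe, hye]
            · left; simp [f, hx, hy, hQx, hQy, hxe, hye]
        · have hQy : ¬ Q y := fun h => hQx ((hQ hx hxy).2 h)
          left; simp [f, hx, hy, hQx, hQy]
    · rintro ⟨x, _⟩ i hi
      change B5Rel (f x) i at hi
      rcases hi with hi | hi | ⟨hi, rfl⟩
      · exact ⟨⟨x, trivial⟩, hR.refl x, hi⟩
      · have hx : x = r := by
          by_contra hx
          simp only [f, if_neg hx] at hi
          split_ifs at hi <;> simp at hi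
        obtain ⟨y, hy⟩ := hsurj i
        exact ⟨⟨y, trivial⟩, hx ▸ hr y, hy⟩
      · have hx : x ≠ r := by rintro rfl; simp [f] at hi
        have hQx : Q x := by by_contra hQx; simp [f, hx, hQx] at hi
        obtain ⟨y, hxy, hy⟩ := f0 x hx hQx
        exact ⟨⟨y, trivial⟩, hxy, hy⟩
  · push Not at hu
    obtain ⟨c, d, h⟩ := hR.exists_isEdge h3 (x := r) fun y _ hy => hu y hy
    have h1 := (h.eq_or a (hr a)).resolve_left (ne_root ha)
    have h2 := (h.eq_or b (hr b)).resolve_left (ne_root hb)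
    rcases h1 with rfl | rfl <;> rcases h2 with rfl | rfl
    exacts [hab .refl, hab (.single ⟨r, h⟩), hab (.single ⟨r, h.symm⟩), hab .refl]

end GoodFrames

theorem boolGen_const {X : Type*} {G : Set (Set X)} (p : Prop) : BoolGen G {_x | p} := by
  by_cases hp : p
  · simpa [hp] using BoolGen.univ
  · simpa [hp] using BoolGen.empty

theorem boolGen_le {n : ℕ} (l m : EuclideanSpace ℝ (Fin n) →ₗ[ℝ] ℝ) :
    BoolGen (halfSpaces n) {p | l p ≤ m p} :=
  .base _ ⟨l - m, 0, by ext p; simp⟩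

theorem boolGen_abs_le {n : ℕ} (l m : EuclideanSpace ℝ (Fin n) →ₗ[ℝ] ℝ) :
    BoolGen (halfSpaces n) {p | |l p| ≤ |m p|} := by
  convert ((boolGen_le l m).inter _ _ (boolGen_le (-l) m)).union _ _
    ((boolGen_le l (-m)).inter _ _ (boolGen_le (-l) (-m))) using 1
  ext p
  simp [le_abs, abs_le']

/-- A coordinate of the plane as a linear functional. -/
noncomputable def coordFun (i : Fin 2) : EuclideanSpace ℝ (Fin 2) →ₗ[ℝ] ℝ :=
  (EuclideanSpace.proj i : EuclideanSpace ℝ (Fin 2) →L[ℝ] ℝ).toLinearMap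

@[simp]
theorem coordFun_apply (i : Fin 2) (p : EuclideanSpace ℝ (Fin 2)) : coordFun i p = p i := rfl

theorem eq_zero_of_coords {p : EuclideanSpace ℝ (Fin 2)} (h0 : p 0 = 0) (h1 : p 1 = 0) :
    p = 0 := by
  ext i
  fin_cases i
  exacts [h0, h1]

theorem boolGen_below (c : ℕ) :
    BoolGen (halfSpaces 2) {p : EuclideanSpace ℝ (Fin 2) | |p 1| ≤ (c : ℝ) * |p 0|} := by
  convert boolGen_abs_le (coordFun 1) ((c : ℝ) • coordFun 0) using 3
  simp [abs_mul]

theorem boolGen_above (c : ℕ) :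
    BoolGen (halfSpaces 2) {p : EuclideanSpace ℝ (Fin 2) | (c : ℝ) * |p 0| ≤ |p 1|} := by
  convert boolGen_abs_le ((c : ℝ) • coordFun 0) (coordFun 1) using 3
  simp [abs_mul]

theorem boolGen_zero : BoolGen (halfSpaces 2) {(0 : EuclideanSpace ℝ (Fin 2))} := by
  convert (boolGen_abs_le (coordFun 0) 0).inter _ _ (boolGen_abs_le (coordFun 1) 0) using 1
  ext p
  simp only [Set.mem_singleton_iff, LinearMap.zero_apply, abs_zero, abs_nonpos_iff,
    coordFun_apply, Set.mem_inter_iff, Set.mem_ofPred_eq]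
  exact ⟨by rintro rfl; simp, fun h => eq_zero_of_coords h.1 h.2⟩

/-- A conical polygonal map to a frame, locally forth and back off the origin, and constantly
equal to `a` on the double cone `k * |x| < |y|`. -/
structure IsFan {W : Type*} (R : W → W → Prop) (k : ℕ) (f : EuclideanSpace ℝ (Fin 2) → W)
    (a : W) : Prop where
  boolGen : ∀ A : Set W, BoolGen (halfSpaces 2) (f ⁻¹' A)
  smul : ∀ t : ℝ, 0 < t → ∀ p, f (t • p) = f p
  forth : ∀ p ≠ 0, ∀ᶠ q in 𝓝 p, R (f p) (f q)
  back : ∀ p ≠ 0, ∀ w, R (f p) w → ∃ᶠ q in 𝓝 p, f q = w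
  last : ∀ p, (k : ℝ) * |p 0| < |p 1| → f p = a

theorem frequently_nhds_self {X : Type*} [TopologicalSpace X] {P : X → Prop} {x : X} (hx : P x) :
    ∃ᶠ y in 𝓝 x, P y :=
  fun h => h.self_of_nhds hx

theorem isFan_const {W : Type*} {R : W → W → Prop} (hR : IsPoset R) {a : W} (ha : IsEnd R a) :
    IsFan R 0 (fun _ => a) a where
  boolGen A := boolGen_const (a ∈ A)
  smul _ _ _ := rfl
  forth _ _ := .of_forall fun _ => hR.refl a
  back _ _ w hw := frequently_nhds_self (ha w hw).symm
  last _ _ := rfl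

/-- The vertical rescaling curve through a point. -/
theorem tendsto_vertical (p : EuclideanSpace ℝ (Fin 2)) :
    Tendsto (fun s : ℝ => !₂[p 0, s * p 1]) (𝓝 1) (𝓝 p) := by
  have hc : Continuous (fun s : ℝ => !₂[p 0, s * p 1]) := by fun_prop
  have h1 : !₂[p 0, 1 * p 1] = p := by
    ext i
    fin_cases i <;> simp
  simpa only [h1] using hc.tendsto 1

theorem eventually_below (c : ℝ) {p : EuclideanSpace ℝ (Fin 2)} (h : |p 1| < c * |p 0|) :
    ∀ᶠ q in 𝓝 p, |q 1| < c * |q 0| :=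
  ContinuousAt.eventually_lt (by fun_prop) (by fun_prop) h

theorem eventually_above (c : ℝ) {p : EuclideanSpace ℝ (Fin 2)} (h : c * |p 0| < |p 1|) :
    ∀ᶠ q in 𝓝 p, c * |q 0| < |q 1| :=
  ContinuousAt.eventually_lt (by fun_prop) (by fun_prop) h

theorem IsFan.extend {W : Type*} {R : W → W → Prop} (hR : IsPoset R) {k : ℕ}
    {f : EuclideanSpace ℝ (Fin 2) → W} {a b e : W} (hf : IsFan R k f a) (he : IsEdge R e a b) :
    ∃ g, IsFan R (k + 1) g b ∧ (∃ p ≠ 0, g p = e) ∧ ∀ p ≠ 0, ∃ q ≠ 0, g q = f p := by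
  classical
  let g : EuclideanSpace ℝ (Fin 2) → W := fun p =>
    if |p 1| < ((k + 1 : ℕ) : ℝ) * |p 0| then f p
    else if ((k + 1 : ℕ) : ℝ) * |p 0| < |p 1| then b else e
  have g_lt : ∀ p, |p 1| < ((k + 1 : ℕ) : ℝ) * |p 0| → g p = f p := fun p hp => if_pos hp
  have g_gt : ∀ p, ((k + 1 : ℕ) : ℝ) * |p 0| < |p 1| → g p = b := fun p hp => by
    simp only [g]; rw [if_neg hp.le.not_gt, if_pos hp]
  have g_eq : ∀ p, |p 1| = ((k + 1 : ℕ) : ℝ) * |p 0| → g p = e := fun p hp => by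
    simp only [g]; rw [if_neg hp.not_lt, if_neg hp.not_gt]
  have ev_lt : ∀ p, |p 1| < ((k + 1 : ℕ) : ℝ) * |p 0| → ∀ᶠ q in 𝓝 p, g q = f q := fun p hp =>
    (eventually_below _ hp).mono g_lt
  have ev_gt : ∀ p, ((k + 1 : ℕ) : ℝ) * |p 0| < |p 1| → ∀ᶠ q in 𝓝 p, g q = b := fun p hp =>
    (eventually_above _ hp).mono g_gt
  have pos : ∀ p : EuclideanSpace ℝ (Fin 2), p ≠ 0 →
      |p 1| = ((k + 1 : ℕ) : ℝ) * |p 0| → 0 < |p 0| := by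
    intro p hp h
    rw [abs_pos]
    intro h0
    rw [h0, abs_zero, mul_zero, abs_eq_zero] at h
    exact hp (eq_zero_of_coords h0 h)
  have ev_eq : ∀ p : EuclideanSpace ℝ (Fin 2), p ≠ 0 →
      |p 1| = ((k + 1 : ℕ) : ℝ) * |p 0| → ∀ᶠ q in 𝓝 p, f q = a := by
    intro p hp h
    have hlt : (k : ℝ) * |p 0| < |p 1| := by
      have := pos p hp h
      rw [h]; push_cast; linarith
    exact (eventually_above _ hlt).mono hf.last
  refine ⟨g, ⟨?_, ?_, ?_, ?_, g_gt⟩, ?_, ?_⟩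
  · intro A
    convert (((boolGen_above (k + 1)).compl.inter _ _ (hf.boolGen A)).union _ _
      ((boolGen_below (k + 1)).compl.inter _ _ (boolGen_const (b ∈ A)))).union _ _
      (((boolGen_above (k + 1)).inter _ _ (boolGen_below (k + 1))).inter _ _
        (boolGen_const (e ∈ A))) using 1
    ext p
    simp only [Set.mem_preimage, Set.mem_union, Set.mem_inter_iff, Set.mem_compl_iff,
      Set.mem_ofPred_eq, not_le]
    rcases lt_trichotomy (|p 1|) (((k + 1 : ℕ) : ℝ) * |p 0|) with h | h | h
    · simp only [g_lt p h, h, h.le, h.not_ge, h.not_gt]; tauto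
    · simp only [g_eq p h, h, le_refl, lt_irrefl]; tauto
    · simp only [g_gt p h, h, h.le, h.not_ge, h.not_gt]; tauto
  · intro t ht p
    have h1 : |(t • p) 1| = t * |p 1| := by simp [abs_mul, abs_of_pos ht]
    have h0 : ((k + 1 : ℕ) : ℝ) * |(t • p) 0| = t * (((k + 1 : ℕ) : ℝ) * |p 0|) := by
      simp [abs_mul, abs_of_pos ht]; ring
    simp only [g, h0, h1, hf.smul t ht, mul_lt_mul_iff_right₀ ht]
  · intro p hp
    rcases lt_trichotomy (|p 1|) (((k + 1 : ℕ) : ℝ) * |p 0|) with h | h | h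
    · filter_upwards [ev_lt p h, hf.forth p hp] with q hq hq'
      rwa [g_lt p h, hq]
    · filter_upwards [ev_eq p hp h] with q hq
      rw [g_eq p h]
      simp only [g]
      split_ifs
      exacts [hq ▸ he.left, he.right, hR.refl e]
    · filter_upwards [ev_gt p h] with q hq
      rw [hq, g_gt p h]
      exact hR.refl b
  · intro p hp w hw
    rcases lt_trichotomy (|p 1|) (((k + 1 : ℕ) : ℝ) * |p 0|) with h | h | h
    · rw [g_lt p h] at hw
      refine ((hf.back p hp w hw).and_eventually (ev_lt p h)).mono ?_
      rintro q ⟨hq, hq'⟩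
      rw [hq', hq]
    · rw [g_eq p h] at hw
      have hy : 0 < |p 1| := h ▸ mul_pos (by positivity) (pos p hp h)
      have hs0 : ∀ᶠ s : ℝ in 𝓝 1, 0 < s := lt_mem_nhds one_pos
      rcases he.eq_or w hw with rfl | rfl | rfl
      · exact frequently_nhds_self (g_eq p h)
      · have hv : Tendsto _ (𝓝[<] (1 : ℝ)) (𝓝 p) :=
          (tendsto_vertical p).mono_left nhdsWithin_le_nhds
        refine hv.frequently (Eventually.frequently ?_)
        filter_upwards [self_mem_nhdsWithin, nhdsWithin_le_nhds hs0,
          nhdsWithin_le_nhds ((tendsto_vertical p).eventually (ev_eq p hp h))] with s hs hs0 hfs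
        rw [g_lt _ ?_, hfs]
        have hs' : s < 1 := hs
        simp only [Matrix.cons_val_zero, Matrix.cons_val_one, ← h, abs_mul,
          abs_of_pos hs0]
        nlinarith
      · have hv : Tendsto _ (𝓝[>] (1 : ℝ)) (𝓝 p) :=
          (tendsto_vertical p).mono_left nhdsWithin_le_nhds
        refine hv.frequently (Eventually.frequently ?_)
        filter_upwards [self_mem_nhdsWithin, nhdsWithin_le_nhds hs0] with s hs hs0
        rw [g_gt _ ?_]
        have hs' : 1 < s := hs
        simp only [Matrix.cons_val_zero, Matrix.cons_val_one, ← h, abs_mul,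
          abs_of_pos hs0]
        nlinarith
    · rw [g_gt p h] at hw
      rw [he.isEnd_right w hw]
      exact (ev_gt p h).frequently
  · have h : |(!₂[1, (k + 1 : ℝ)] : EuclideanSpace ℝ (Fin 2)) 1| =
        ((k + 1 : ℕ) : ℝ) * |(!₂[1, (k + 1 : ℝ)] : EuclideanSpace ℝ (Fin 2)) 0| := by
      have : (0 : ℝ) ≤ k + 1 := by positivity
      simp [abs_of_nonneg this]
    refine ⟨_, ?_, g_eq _ h⟩
    intro h0
    have := congrArg (fun p : EuclideanSpace ℝ (Fin 2) => p 0) h0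
    simp at this
  · intro p hp
    by_cases h : |p 1| < ((k + 1 : ℕ) : ℝ) * |p 0|
    · exact ⟨p, hp, g_lt p h⟩
    · push Not at h
      have hfp : f p = a := by
        apply hf.last
        by_contra h'
        push Not at h'
        have h0 : p 0 = 0 := by
          rw [← abs_nonpos_iff]
          push_cast at h
          linarith
        have h1 : p 1 = 0 := by
          rw [← abs_nonpos_iff]
          simpa [h0] using h'
        exact hp (eq_zero_of_coords h0 h1)
      have hk : (0 : ℝ) ≤ k + 1 / 2 := by positivity
      refine ⟨!₂[1, (k + 1 / 2 : ℝ)], ?_, ?_⟩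
      · intro h0
        have := congrArg (fun p : EuclideanSpace ℝ (Fin 2) => p 0) h0
        simp at this
      · rw [g_lt, hfp]
        · apply hf.last
          simp only [Matrix.cons_val_zero, Matrix.cons_val_one,
            abs_of_nonneg hk]
          norm_num
        · simp only [Matrix.cons_val_zero, Matrix.cons_val_one,
            abs_of_nonneg hk]
          push_cast
          norm_num

/-- Some fan ends at `a` and attains all elements of `T` off the origin. -/
def FanCovers {W : Type*} (R : W → W → Prop) (a : W) (T : Set W) : Prop :=
  ∃ k f, IsFan R k f a ∧ ∀ w ∈ T, ∃ p ≠ 0, f p = w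

theorem FanCovers.insert {W : Type*} {R : W → W → Prop} (hR : IsPoset R) {a b e : W} {T : Set W}
    (h : FanCovers R a T) (he : IsEdge R e a b) : FanCovers R b (insert e T) := by
  obtain ⟨k, f, hf, hT⟩ := h
  obtain ⟨g, hg, hge, hgf⟩ := hf.extend hR he
  refine ⟨k + 1, g, hg, ?_⟩
  rintro w (rfl | hw)
  · exact hge
  · obtain ⟨p, hp, rfl⟩ := hT w hw
    exact hgf p hp

theorem FanCovers.reach {W : Type*} {R : W → W → Prop} (hR : IsPoset R) {a b : W} {T : Set W}
    (h : FanCovers R a T) (hab : Relation.ReflTransGen (Link R) a b) : FanCovers R b T := by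
  induction hab with
  | refl => exact h
  | tail _ hlink ih =>
    obtain ⟨e, he⟩ := hlink
    obtain ⟨k, f, hf, hT⟩ := ih.insert hR he
    exact ⟨k, f, hf, fun w hw => hT w (Set.mem_insert_of_mem e hw)⟩

theorem IsPoset.exists_fanCovers {W : Type*} [Finite W] {R : W → W → Prop} (hR : IsPoset R)
    (h3 : ¬ Subreducible R B3Rel) (h4 : ¬ Subreducible R B4Rel) (h5 : ¬ Subreducible R B5Rel)
    {r : W} (hr : ∀ x, R r x) : ∃ a, FanCovers R a {x | x ≠ r} := by
  suffices h : ∃ a, IsEnd R a ∧ FanCovers R a {x | x ≠ r} by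
    obtain ⟨a, -, ha⟩ := h
    exact ⟨a, ha⟩
  refine Set.Finite.induction_on_subset {x | x ≠ r} (Set.toFinite _) ?_ ?_
  · obtain ⟨a, -, ha⟩ := hR.exists_isEnd r
    exact ⟨a, ha, 0, _, isFan_const hR ha, by simp⟩
  · rintro x T hx - - ⟨a, ha, hT⟩
    obtain ⟨c, d, he⟩ := hR.exists_isEdge_of_ne_root h3 h4 hr hx
    exact ⟨d, he.isEnd_right, (hT.reach hR
      (hR.reach_of_not_subreducible h3 h4 h5 hr ha he.isEnd_left)).insert hR he⟩

theorem valid_of_polygonally_valid {φ : Fml}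
    (h : ∀ ν : ℕ → Set (EuclideanSpace ℝ (Fin 2)),
      (∀ p, BoolGen (halfSpaces 2) (ν p)) → ∀ x, x ∈ topoSem ν φ)
    {W : Type*} [Finite W] {R : W → W → Prop} (hR : IsPoset R)
    (h3 : ¬ Subreducible R B3Rel) (h4 : ¬ Subreducible R B4Rel) (h5 : ¬ Subreducible R B5Rel)
    {r : W} (hr : ∀ x, R r x) (μ : ℕ → Set W) (w : W) : w ∈ kripkeSem R μ φ := by
  classical
  obtain ⟨a, k, f, hf, hsurj⟩ := hR.exists_fanCovers h3 h4 h5 hr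
  let g : EuclideanSpace ℝ (Fin 2) → W := fun p => if p = 0 then r else f p
  have g0 : g 0 = r := if_pos rfl
  have gf : ∀ p ≠ 0, g p = f p := fun p hp => if_neg hp
  have ev : ∀ p ≠ 0, ∀ᶠ q in 𝓝 p, g q = f q := fun p hp =>
    (isOpen_compl_singleton.eventually_mem hp).mono gf
  have gsurj : ∀ w, ∃ p, g p = w := by
    intro w
    by_cases hw : w = r
    · exact ⟨0, hw ▸ g0⟩
    · obtain ⟨p, hp, hpw⟩ := hsurj w hw
      exact ⟨p, (gf p hp).trans hpw⟩
  have hpoly : ∀ q, BoolGen (halfSpaces 2) (g ⁻¹' μ q) := by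
    intro q
    convert (boolGen_zero.inter _ _ (boolGen_const (r ∈ μ q))).union _ _
      (boolGen_zero.compl.inter _ _ (hf.boolGen (μ q))) using 1
    ext p
    by_cases hp : p = 0
    · subst hp; simp [g0]
    · simp [gf p hp, hp]
  obtain ⟨x, rfl⟩ := gsurj w
  refine (topoSem_iff_kripkeSem (R := R) (f := g) (μ := μ) isOpen_univ ?_ ?_ φ
    (fun _ _ _ _ => Iff.rfl) x trivial).1 (h _ hpoly x)
  · rintro p -
    by_cases hp : p = 0
    · subst hp
      exact .of_forall fun q => g0 ▸ hr _
    · filter_upwards [ev p hp, hf.forth p hp] with q hq hq'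
      rwa [hq, gf p hp]
  · rintro p - w hw
    by_cases hp : p = 0
    · subst hp
      by_cases hwr : w = r
      · exact frequently_nhds_self (g0.trans hwr.symm)
      · obtain ⟨p, hp, hpw⟩ := hsurj w hwr
        have ht : Tendsto (fun t : ℝ => t • p) (𝓝[>] 0) (𝓝 0) := by
          have : Continuous (fun t : ℝ => t • p) := by fun_prop
          simpa using (this.tendsto 0).mono_left nhdsWithin_le_nhds
        refine ht.frequently (Eventually.frequently ?_)
        filter_upwards [self_mem_nhdsWithin] with t ht
        have ht' : 0 < t := ht
        rw [gf _ (smul_ne_zero ht'.ne' hp), hf.smul t ht', hpw]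
    · rw [gf p hp] at hw
      refine ((hf.back p hp w hw).and_eventually (ev p hp)).mono ?_
      rintro q ⟨hq, hq'⟩
      rw [hq', hq]

/-- The order-theoretic features of the local structure of the plane around a point. -/
structure IsPlanarFrame {W : Type*} (R : W → W → Prop) (r : W) : Prop extends IsPoset R where
  root : ∀ x, R r x
  depth : ∀ d ≠ r, ∀ a b, R d a → a ≠ d → R a b → b = a
  width : ∀ d ≠ r, ∀ a b c, R d a → R d b → R d c → a ≠ d → b ≠ d → c ≠ d →
    a = b ∨ a = c ∨ b = c
  connected : ∀ P : W → Prop, (∀ x y, x ≠ r → R x y → (P x ↔ P y)) →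
    ∀ x y, x ≠ r → y ≠ r → P x → P y

section PlanarFrames

variable {W : Type*} {R : W → W → Prop}

theorem IsPoset.not_subreducible_B1 [Finite W] (hR : IsPoset R) : ¬ Subreducible R B1Rel := by
  rintro ⟨D, hD, f, hf, -, hback⟩
  obtain ⟨⟨x, hx⟩, -⟩ := hf 0
  obtain ⟨y, -, hy, hmax⟩ := hR.exists_maximal (· ∈ D) hx
  obtain ⟨z, hz⟩ := exists_ne (f ⟨y, hy⟩)
  obtain ⟨⟨w, hw⟩, hyw, rfl⟩ := hback ⟨y, hy⟩ z trivial
  obtain rfl := hmax w hyw hw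
  exact hz rfl

theorem IsPoset.not_subreducible_B2 [Finite W] (hR : IsPoset R) : ¬ Subreducible R B2Rel := by
  rintro ⟨D, hD, f, hf, -, hback⟩
  obtain ⟨⟨x, hx⟩, hx0⟩ := hf 0
  obtain ⟨y, -, ⟨hy, hy1⟩, hmax⟩ := hR.exists_maximal
    (fun x => ∃ h : x ∈ D, (f ⟨x, h⟩).val ≤ 1) (x := x) ⟨hx, by simp [hx0]⟩
  obtain ⟨z, hz1, hz⟩ : ∃ z : Fin 3, z.val ≤ 1 ∧ z ≠ f ⟨y, hy⟩ := by
    generalize f ⟨y, hy⟩ = i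
    revert i
    decide
  obtain ⟨⟨w, hw⟩, hyw, rfl⟩ := hback ⟨y, hy⟩ z (Or.inl hy1)
  obtain rfl := hmax w hyw ⟨hw, hz1⟩
  exact hz rfl

theorem IsPlanarFrame.not_subreducible_B3 {r : W} (hR : IsPlanarFrame R r) :
    ¬ Subreducible R B3Rel := by
  rintro ⟨D, hD, f, hf, hforth, hback⟩
  have ne_of : ∀ {u v : D} {i j}, f u = i → f v = j → i ≠ j → u.1 ≠ v.1 := by
    rintro u v _ _ rfl rfl hij huv
    exact hij (congrArg f (Subtype.ext huv))
  have key : ∀ x : D, f x = 0 → x.1 = r := by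
    intro x hx
    by_contra hne
    obtain ⟨a, hxa, ha⟩ := hback x 1 (Or.inl hx)
    obtain ⟨b, hxb, hb⟩ := hback x 2 (Or.inl hx)
    obtain ⟨c, hxc, hc⟩ := hback x 3 (Or.inl hx)
    rcases hR.width x hne a b c hxa hxb hxc (ne_of ha hx (by decide)) (ne_of hb hx (by decide))
      (ne_of hc hx (by decide)) with h | h | h
    exacts [ne_of ha hb (by decide) h, ne_of ha hc (by decide) h, ne_of hb hc (by decide) h]
  obtain ⟨x, hx⟩ := hf 0
  have hxr := key x hx
  have hall : ∀ w, w ∈ D := fun w => hD x x.2 w (hxr ▸ hR.root w)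
  obtain ⟨a, ha⟩ := hf 1
  obtain ⟨c, hc⟩ := hf 3
  have hac : f ⟨a, hall a⟩ = 3 := by
    refine hR.connected (fun w => f ⟨w, hall w⟩ = 3) ?_ c a
      (hxr ▸ ne_of hc hx (by decide)) (hxr ▸ ne_of ha hx (by decide)) hc
    intro u v hu huv
    rcases hforth ⟨u, hall u⟩ ⟨v, hall v⟩ huv with h | h
    · exact absurd (key _ h) hu
    · rw [h]
  rw [ha] at hac
  exact absurd hac (by decide)

theorem IsPlanarFrame.not_subreducible_B4 {r : W} (hR : IsPlanarFrame R r) :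
    ¬ Subreducible R B4Rel := by
  rintro ⟨D, hD, f, hf, -, hback⟩
  have ne_of : ∀ {u v : D} {i j}, f u = i → f v = j → i ≠ j → u.1 ≠ v.1 := by
    rintro u v _ _ rfl rfl hij huv
    exact hij (congrArg f (Subtype.ext huv))
  obtain ⟨x, hx⟩ := hf 3
  obtain ⟨y, hxy, hy⟩ := hback x 2 (by rw [hx]; simp [B4Rel])
  obtain ⟨z, hyz, hz⟩ := hback y 1 (by rw [hy]; simp [B4Rel])
  obtain ⟨u, hzu, hu⟩ := hback z 0 (by rw [hz]; simp [B4Rel])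
  have hyr : y.1 ≠ r := fun h =>
    ne_of hx hy (by decide) (hR.antisymm _ _ hxy (h ▸ hR.root x))
  exact ne_of hu hz (by decide) (hR.depth y hyr z u hyz (ne_of hz hy (by decide)) hzu)

theorem IsPlanarFrame.not_subreducible_B5 {r : W} (hR : IsPlanarFrame R r) :
    ¬ Subreducible R B5Rel := by
  rintro ⟨D, hD, f, hf, hforth, hback⟩
  have ne_of : ∀ {u v : D} {i j}, f u = i → f v = j → i ≠ j → u.1 ≠ v.1 := by
    rintro u v _ _ rfl rfl hij huv
    exact hij (congrArg f (Subtype.ext huv))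
  have key : ∀ x : D, f x = 2 → x.1 = r := by
    intro x hx
    by_contra hne
    obtain ⟨a, hxa, ha⟩ := hback x 1 (Or.inr (Or.inl hx))
    obtain ⟨b, hab, hb⟩ := hback a 0 (Or.inr (Or.inr ⟨ha, rfl⟩))
    exact ne_of hb ha (by decide) (hR.depth x hne a b hxa (ne_of ha hx (by decide)) hab)
  obtain ⟨x, hx⟩ := hf 2
  have hxr := key x hx
  have hall : ∀ w, w ∈ D := fun w => hD x x.2 w (hxr ▸ hR.root w)
  obtain ⟨a, ha⟩ := hf 0
  obtain ⟨c, hc⟩ := hf 3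
  have hac : f ⟨a, hall a⟩ = 3 := by
    refine hR.connected (fun w => f ⟨w, hall w⟩ = 3) ?_ c a
      (hxr ▸ ne_of hc hx (by decide)) (hxr ▸ ne_of ha hx (by decide)) hc
    intro u v hu huv
    rcases hforth ⟨u, hall u⟩ ⟨v, hall v⟩ huv with h | h | ⟨h, h'⟩
    · rw [h]
    · exact absurd (key _ h) hu
    · rw [h, h']; decide
  rw [ha] at hac
  exact absurd hac (by decide)

end PlanarFrames

section SignVectors

variable {n : ℕ} (F : Set (EuclideanSpace ℝ (Fin n) →ₗ[ℝ] ℝ))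

/-- The signs of the functionals in `F` at a point. -/
noncomputable def signVec (u : EuclideanSpace ℝ (Fin n)) : F → SignType :=
  fun l => SignType.sign (l.1 u)

/-- The face order on the sign vectors realised by points. -/
def FaceRel (σ τ : Set.range (signVec F)) : Prop := ∀ l, σ.1 l ≠ 0 → τ.1 l = σ.1 l

/-- The face of the arrangement `F` containing a point. -/
noncomputable def face (u : EuclideanSpace ℝ (Fin n)) : Set.range (signVec F) :=
  Set.rangeFactorization (signVec F) u

theorem face_surjective : Function.Surjective (face F) := Set.rangeFactorization_surjective

variable {F}

theorem faceRel_face {u v : EuclideanSpace ℝ (Fin n)} :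
    FaceRel F (face F u) (face F v) ↔
      ∀ l ∈ F, l u ≠ 0 → SignType.sign (l v) = SignType.sign (l u) := by
  constructor
  · intro h l hl hu
    exact h ⟨l, hl⟩ (sign_ne_zero.2 hu)
  · rintro h ⟨l, hl⟩ hu
    exact h l hl (sign_ne_zero.1 hu)

theorem face_eq_face {u v : EuclideanSpace ℝ (Fin n)} :
    face F u = face F v ↔ ∀ l ∈ F, SignType.sign (l u) = SignType.sign (l v) := by
  constructor
  · intro h l hl
    exact congrFun (congrArg Subtype.val h) ⟨l, hl⟩
  · intro h
    exact Subtype.ext (funext fun l => h l.1 l.2)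

theorem isPoset_faceRel : IsPoset (FaceRel F) where
  refl _ _ _ := rfl
  trans x y z hxy hyz l hl := by
    rw [hyz l (by rwa [hxy l hl]), hxy l hl]
  antisymm x y hxy hyx := by
    refine Subtype.ext (funext fun l => ?_)
    by_cases hx : x.1 l = 0
    · by_cases hy : y.1 l = 0
      · rw [hx, hy]
      · exact hyx l hy
    · exact (hxy l hx).symm

theorem eventually_sign_eq {f : EuclideanSpace ℝ (Fin n) → ℝ} (hf : Continuous f)
    {u : EuclideanSpace ℝ (Fin n)} (hu : f u ≠ 0) :
    ∀ᶠ v in 𝓝 u, SignType.sign (f v) = SignType.sign (f u) := by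
  rcases lt_or_gt_of_ne hu with h | h
  · filter_upwards [hf.continuousAt.eventually_lt continuousAt_const h] with v hv
    rw [sign_neg h, sign_neg hv]
  · filter_upwards [continuousAt_const.eventually_lt hf.continuousAt h] with v hv
    rw [sign_pos h, sign_pos hv]

theorem eventually_faceRel (hF : F.Finite) (u : EuclideanSpace ℝ (Fin n)) :
    ∀ᶠ v in 𝓝 u, FaceRel F (face F u) (face F v) := by
  simp only [faceRel_face]
  rw [eventually_all_finite hF]
  intro l _
  by_cases hu : l u = 0
  · simp [hu]
  · filter_upwards [eventually_sign_eq l.continuous_of_finiteDimensional hu] with v hv _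
    exact hv

theorem frequently_face_eq (hF : F.Finite) {u : EuclideanSpace ℝ (Fin n)}
    {σ : Set.range (signVec F)} (h : FaceRel F (face F u) σ) : ∃ᶠ v in 𝓝 u, face F v = σ := by
  obtain ⟨w, rfl⟩ := face_surjective F σ
  have ht : Tendsto (fun t : ℝ => u + t • w) (𝓝[>] 0) (𝓝 u) := by
    have : Continuous (fun t : ℝ => u + t • w) := by fun_prop
    simpa using (this.tendsto 0).mono_left nhdsWithin_le_nhds
  refine ht.frequently (Eventually.frequently ?_)
  filter_upwards [self_mem_nhdsWithin, ht.eventually (eventually_faceRel hF u)] with t ht htr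
  have ht' : 0 < t := ht
  rw [face_eq_face]
  rw [faceRel_face] at h htr
  intro l hl
  by_cases hu : l u = 0
  · simp [hu, sign_mul, sign_pos ht']
  · rw [htr l hl hu, h l hl hu]

theorem finite_range_signVec (hF : F.Finite) : Finite (Set.range (signVec F)) := by
  have := hF.to_subtype
  infer_instance

end SignVectors

section PlaneArrangements

variable {F : Set (EuclideanSpace ℝ (Fin 2) →ₗ[ℝ] ℝ)}

/-- The side of the line spanned by `v` on which a point lies. -/
noncomputable def side (v u : EuclideanSpace ℝ (Fin 2)) : SignType :=
  SignType.sign (v 0 * u 1 - v 1 * u 0)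

theorem exists_sign_eq_side {v : EuclideanSpace ℝ (Fin 2)} (hv : v ≠ 0) :
    ∃ w : EuclideanSpace ℝ (Fin 2), ∀ (l : EuclideanSpace ℝ (Fin 2) →ₗ[ℝ] ℝ) (u), l v = 0 →
      SignType.sign (l u) = side v u * SignType.sign (l w) := by
  have hN : 0 < v 0 ^ 2 + v 1 ^ 2 := by
    by_contra h
    exact hv (eq_zero_of_coords (by nlinarith [sq_nonneg (v 0), sq_nonneg (v 1)])
      (by nlinarith [sq_nonneg (v 0), sq_nonneg (v 1)]))
  refine ⟨!₂[-v 1, v 0], fun l u hl => ?_⟩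
  have hu : (v 0 ^ 2 + v 1 ^ 2) • u = (v 0 * u 0 + v 1 * u 1) • v +
      (v 0 * u 1 - v 1 * u 0) • (!₂[-v 1, v 0] : EuclideanSpace ℝ (Fin 2)) := by
    ext i
    fin_cases i <;> simp <;> ring
  have h := congrArg (fun x => SignType.sign (l x)) hu
  simpa [hl, sign_mul, sign_pos hN, side] using h

theorem face_eq_of_side_eq {v a b : EuclideanSpace ℝ (Fin 2)} (hv : v ≠ 0)
    (ha : FaceRel F (face F v) (face F a)) (hb : FaceRel F (face F v) (face F b))
    (hab : side v a = side v b) : face F a = face F b := by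
  obtain ⟨w, hw⟩ := exists_sign_eq_side hv
  rw [faceRel_face] at ha hb
  rw [face_eq_face]
  intro l hl
  by_cases hlv : l v = 0
  · rw [hw l a hlv, hw l b hlv, hab]
  · rw [ha l hl hlv, hb l hl hlv]

theorem side_ne_zero {v a : EuclideanSpace ℝ (Fin 2)} (hv : v ≠ 0)
    (ha : FaceRel F (face F v) (face F a)) (hav : face F a ≠ face F v) : side v a ≠ 0 := by
  intro h
  refine hav (face_eq_of_side_eq hv ha (isPoset_faceRel.refl _) ?_)
  rw [h]
  simp [side, mul_comm]

theorem face_depth {v a b : EuclideanSpace ℝ (Fin 2)} (hv : v ≠ 0)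
    (ha : FaceRel F (face F v) (face F a)) (hav : face F a ≠ face F v)
    (hab : FaceRel F (face F a) (face F b)) : face F b = face F a := by
  have hvb := isPoset_faceRel.trans _ _ _ ha hab
  have hbv : face F b ≠ face F v := by
    intro h
    rw [h] at hab
    exact hav (isPoset_faceRel.antisymm _ _ hab ha)
  refine face_eq_of_side_eq hv hvb ha ?_
  obtain ⟨w, hw⟩ := exists_sign_eq_side hv
  obtain ⟨l, hl, hne⟩ : ∃ l ∈ F, SignType.sign (l a) ≠ SignType.sign (l v) := by
    by_contra! h
    exact hav (face_eq_face.2 h)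
  rw [faceRel_face] at ha hab
  have hlv : l v = 0 := by
    by_contra hlv
    exact hne (ha l hl hlv)
  have hla : l a ≠ 0 := by
    intro hla
    rw [hla, hlv] at hne
    exact hne rfl
  have h := hab l hl hla
  have hlw : SignType.sign (l w) ≠ 0 := by
    intro h0
    rw [← sign_ne_zero, hw l a hlv, h0, mul_zero] at hla
    exact hla rfl
  rw [hw l a hlv, hw l b hlv] at h
  exact mul_right_cancel₀ hlw h

theorem isPlanarFrame_faceRel (hF : F.Finite) (hcoord : ∀ i, coordFun i ∈ F) :
    IsPlanarFrame (FaceRel F) (face F 0) := by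
  have ne_zero : ∀ {u}, face F u ≠ face F 0 → u ≠ 0 := by rintro u hu rfl; exact hu rfl
  have face_ne : ∀ {u}, u ≠ 0 → face F u ≠ face F 0 := by
    intro u hu h
    rw [face_eq_face] at h
    have hz : ∀ i, u i = 0 := fun i => by
      have := h _ (hcoord i)
      simpa using this
    exact hu (eq_zero_of_coords (hz 0) (hz 1))
  refine { toIsPoset := isPoset_faceRel, root := ?_, depth := ?_, width := ?_, connected := ?_ }
  · intro x
    obtain ⟨u, rfl⟩ := face_surjective F x
    rw [faceRel_face]
    simp
  · intro d hd a b hda had hab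
    obtain ⟨v, rfl⟩ := face_surjective F d
    obtain ⟨a, rfl⟩ := face_surjective F a
    obtain ⟨b, rfl⟩ := face_surjective F b
    exact face_depth (ne_zero hd) hda had hab
  · intro d hd a b c ha hb hc had hbd hcd
    obtain ⟨v, rfl⟩ := face_surjective F d
    obtain ⟨a, rfl⟩ := face_surjective F a
    obtain ⟨b, rfl⟩ := face_surjective F b
    obtain ⟨c, rfl⟩ := face_surjective F c
    have hv := ne_zero hd
    have h : ∀ i j k : SignType, i ≠ 0 → j ≠ 0 → k ≠ 0 → i = j ∨ i = k ∨ j = k := by decide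
    rcases h _ _ _ (side_ne_zero hv ha had) (side_ne_zero hv hb hbd) (side_ne_zero hv hc hcd)
      with h | h | h
    · exact .inl (face_eq_of_side_eq hv ha hb h)
    · exact .inr (.inl (face_eq_of_side_eq hv ha hc h))
    · exact .inr (.inr (face_eq_of_side_eq hv hb hc h))
  · intro P hP x y hx hy hPx
    obtain ⟨u, rfl⟩ := face_surjective F x
    obtain ⟨v, rfl⟩ := face_surjective F y
    have hopen : ∀ Q : Prop → Prop, IsOpen {u | u ≠ 0 ∧ Q (P (face F u))} := by
      intro Q
      rw [isOpen_iff_mem_nhds]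
      rintro u ⟨hu, hQ⟩
      filter_upwards [isOpen_compl_singleton.mem_nhds hu, eventually_faceRel hF u] with w hw hr
      refine ⟨hw, ?_⟩
      rwa [← propext (hP _ _ (face_ne hu) hr)]
    have hconn : IsPreconnected ({0}ᶜ : Set (EuclideanSpace ℝ (Fin 2))) :=
      (isConnected_compl_singleton_of_one_lt_rank (by
        rw [← Module.finrank_eq_rank]; simp) 0).isPreconnected
    by_contra hPy
    obtain ⟨w, -, hw1, hw2⟩ := hconn _ _ (hopen id) (hopen Not)
      (fun w hw => (em (P (face F w))).imp (⟨hw, ·⟩) (⟨hw, ·⟩))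
      ⟨u, ne_zero hx, ne_zero hx, hPx⟩ ⟨v, ne_zero hy, ne_zero hy, hPy⟩
    exact hw2.2 hw1.2

end PlaneArrangements

/-- Near a point, membership in `A` depends only on the signs of the functionals in `F` based at
that point. -/
def LocallyCut {n : ℕ} (x : EuclideanSpace ℝ (Fin n)) (F : Set (EuclideanSpace ℝ (Fin n) →ₗ[ℝ] ℝ))
    (O : Set (EuclideanSpace ℝ (Fin n))) (A : Set (EuclideanSpace ℝ (Fin n))) : Prop :=
  ∀ y ∈ O, ∀ z ∈ O, face F (y - x) = face F (z - x) → (y ∈ A ↔ z ∈ A)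

theorem LocallyCut.mono {n : ℕ} {x : EuclideanSpace ℝ (Fin n)}
    {F F' : Set (EuclideanSpace ℝ (Fin n) →ₗ[ℝ] ℝ)} {O O' A : Set (EuclideanSpace ℝ (Fin n))}
    (h : LocallyCut x F O A) (hF : F ⊆ F') (hO : O' ⊆ O) : LocallyCut x F' O' A :=
  fun y hy z hz hyz => h y (hO hy) z (hO hz) <| face_eq_face.2 fun l hl =>
    face_eq_face.1 hyz l (hF hl)

theorem exists_locallyCut {n : ℕ} (x : EuclideanSpace ℝ (Fin n))
    {A : Set (EuclideanSpace ℝ (Fin n))} (hA : BoolGen (halfSpaces n) A) :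
    ∃ F O, F.Finite ∧ IsOpen O ∧ x ∈ O ∧ LocallyCut x F O A := by
  induction hA with
  | base A h =>
    obtain ⟨l, a, rfl⟩ := h
    have hl : Continuous l := l.continuous_of_finiteDimensional
    rcases lt_trichotomy (l x) a with h | h | h
    · exact ⟨∅, {y | l y < a}, Set.finite_empty, isOpen_lt hl continuous_const, h,
        fun y hy z hz _ => iff_of_true (show l y ≤ a from le_of_lt hy)
          (show l z ≤ a from le_of_lt hz)⟩
    · refine ⟨{l}, Set.univ, Set.finite_singleton l, isOpen_univ, trivial,
        fun y _ z _ hyz => ?_⟩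
      have hs := face_eq_face.1 hyz l rfl
      have hle : ∀ y, l y ≤ a ↔ SignType.sign (l (y - x)) ≤ 0 := by
        intro y
        rw [sign_nonpos_iff, map_sub, h, sub_nonpos]
      change l y ≤ a ↔ l z ≤ a
      rw [hle, hle, hs]
    · exact ⟨∅, {y | a < l y}, Set.finite_empty, isOpen_lt continuous_const hl, h,
        fun y hy z hz _ => iff_of_false (show ¬ l y ≤ a from not_le_of_gt hy)
          (show ¬ l z ≤ a from not_le_of_gt hz)⟩
  | empty => exact ⟨∅, Set.univ, Set.finite_empty, isOpen_univ, trivial, fun _ _ _ _ _ => Iff.rfl⟩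
  | univ => exact ⟨∅, Set.univ, Set.finite_empty, isOpen_univ, trivial, fun _ _ _ _ _ => Iff.rfl⟩
  | union A B _ _ ihA ihB =>
    obtain ⟨F, O, hF, hO, hx, h⟩ := ihA
    obtain ⟨F', O', hF', hO', hx', h'⟩ := ihB
    exact ⟨F ∪ F', O ∩ O', hF.union hF', hO.inter hO', ⟨hx, hx'⟩, fun y hy z hz hyz =>
      or_congr (h.mono Set.subset_union_left Set.inter_subset_left y hy z hz hyz)
        (h'.mono Set.subset_union_right Set.inter_subset_right y hy z hz hyz)⟩
  | inter A B _ _ ihA ihB =>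
    obtain ⟨F, O, hF, hO, hx, h⟩ := ihA
    obtain ⟨F', O', hF', hO', hx', h'⟩ := ihB
    exact ⟨F ∪ F', O ∩ O', hF.union hF', hO.inter hO', ⟨hx, hx'⟩, fun y hy z hz hyz =>
      and_congr (h.mono Set.subset_union_left Set.inter_subset_left y hy z hz hyz)
        (h'.mono Set.subset_union_right Set.inter_subset_right y hy z hz hyz)⟩
  | compl A _ ih =>
    obtain ⟨F, O, hF, hO, hx, h⟩ := ih
    exact ⟨F, O, hF, hO, hx, fun y hy z hz hyz => not_congr (h y hy z hz hyz)⟩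

theorem exists_locallyCut_forall {n : ℕ} (x : EuclideanSpace ℝ (Fin n))
    {ν : ℕ → Set (EuclideanSpace ℝ (Fin n))} (hν : ∀ p, BoolGen (halfSpaces n) (ν p))
    (s : Finset ℕ) :
    ∃ F O, F.Finite ∧ IsOpen O ∧ x ∈ O ∧ ∀ p ∈ s, LocallyCut x F O (ν p) := by
  choose F O hF hO hx h using fun p => exists_locallyCut x (hν p)
  exact ⟨⋃ p ∈ s, F p, ⋂ p ∈ s, O p, s.finite_toSet.biUnion fun p _ => hF p,
    isOpen_biInter_finset fun p _ => hO p, Set.mem_iInter₂.2 fun p _ => hx p,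
    fun p hp => (h p).mono (Set.subset_biUnion_of_mem (u := F) hp)
      (Set.biInter_subset_of_mem (t := O) hp)⟩

theorem exists_planarFrame_of_polygonal {ν : ℕ → Set (EuclideanSpace ℝ (Fin 2))}
    (hν : ∀ p, BoolGen (halfSpaces 2) (ν p)) (φ : Fml) (x : EuclideanSpace ℝ (Fin 2)) :
    ∃ (W : Type) (R : W → W → Prop) (r : W) (μ : ℕ → Set W), Finite W ∧ IsPlanarFrame R r ∧
      (x ∈ topoSem ν φ ↔ r ∈ kripkeSem R μ φ) := by
  obtain ⟨F₀, O, hF₀, hO, hx, h⟩ := exists_locallyCut_forall x hν φ.vars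
  let F := F₀ ∪ Set.range coordFun
  have hF : F.Finite := hF₀.union (Set.finite_range _)
  refine ⟨_, FaceRel F, face F 0, fun p => {σ | ∃ y ∈ O, y ∈ ν p ∧ face F (y - x) = σ},
    finite_range_signVec hF, isPlanarFrame_faceRel hF fun i => Or.inr ⟨i, rfl⟩, ?_⟩
  have htr : ∀ y, Tendsto (fun z => z - x) (𝓝 y) (𝓝 (y - x)) := fun y =>
    (continuous_id.sub continuous_const).tendsto y
  have htr' : ∀ y, Tendsto (fun z => z + x) (𝓝 (y - x)) (𝓝 y) := fun y => by
    simpa using (continuous_add_const x).tendsto (y - x)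
  rw [← sub_self x]
  refine topoSem_iff_kripkeSem (f := fun y => face F (y - x)) hO
    (fun y _ => (htr y).eventually (eventually_faceRel hF (y - x)))
    (fun y _ σ hσ => (htr' y).frequently ?_) φ ?_ x hx
  · simpa using frequently_face_eq hF hσ
  · intro p hp y hy
    refine ⟨fun hyp => ⟨y, hy, hyp, rfl⟩, ?_⟩
    rintro ⟨z, hz, hzp, hzy⟩
    exact ((h p hp).mono Set.subset_union_left subset_rfl z hz y hy hzy).1 hzp

/-- A formula is valid on the polygonal plane iff it is valid on every finite rooted
reflexive-transitive Kripke frame not subreducible to any forbidden frame. -/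
theorem PL2_iff_valid_on_good_frames (φ : Fml) :
    (∀ ν : ℕ → Set (EuclideanSpace ℝ (Fin 2)),
      (∀ p, BoolGen (halfSpaces 2) (ν p)) → ∀ x, x ∈ topoSem ν φ) ↔
    (∀ (W : Type) (R : W → W → Prop), Finite W →
      Reflexive R → Transitive R → (∃ r, ∀ x, R r x) →
      ¬ Subreducible R B1Rel → ¬ Subreducible R B2Rel → ¬ Subreducible R B3Rel →
      ¬ Subreducible R B4Rel → ¬ Subreducible R B5Rel →
      ∀ (μ : ℕ → Set W) (w : W), w ∈ kripkeSem R μ φ) := by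
  constructor
  · intro h W R _ hrefl htrans ⟨r, hr⟩ h1 h2 h3 h4 h5 μ w
    have hR : IsPoset R := ⟨hrefl, fun _ _ _ hxy hyz => htrans hxy hyz, fun _ _ =>
      antisymm_of_not_subreducible hrefl (fun _ _ _ hxy hyz => htrans hxy hyz) h1 h2⟩
    exact valid_of_polygonally_valid h hR h3 h4 h5 hr μ w
  · intro h ν hν x
    obtain ⟨W, R, r, μ, hW, hR, hx⟩ := exists_planarFrame_of_polygonal hν φ x
    exact hx.2 (h W R hW hR.refl (fun x y z => hR.trans x y z) ⟨r, hR.root⟩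
      hR.toIsPoset.not_subreducible_B1 hR.toIsPoset.not_subreducible_B2 hR.not_subreducible_B3
      hR.not_subreducible_B4 hR.not_subreducible_B5 μ r)
end
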